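/- There are no integers n > 500, digits d₁, d₂ ∈ {0,…,9} with d₁ ≠ d₂ and d₁ > 0, and integers ℓ₁, ℓ₂ ≥ 1 satisfying P_n = d₁·((10^{ℓ₁} − 1)/9)·10^{ℓ₂} + d₂·((10^{ℓ₂} − 1)/9). -/

import Mathlib

/-- The Padovan sequence: `P 0 = 0`, `P 1 = 1`, `P 2 = 1`, `P (n+3) = P (n+1) + P n`. -/
def padovan : ℕ → ℕ
  | 0 => 0
  | 1 => 1
  | 2 => 1
  | n + 3 => padovan (n + 1) + padovan n


/-! ### Extrapolation lemma -/

lemma bk_iter_leibniz (G : ℂ → ℂ) (hG : ContDiff ℂ ⊤ G) (a c : ℂ) (k : ℕ) :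
    iteratedDeriv (k + 1) (fun z => c + (z - a) * G z) =
      fun z => (k + 1 : ℂ) * iteratedDeriv k G z + (z - a) * iteratedDeriv (k + 1) G z := by
  have hd : ∀ j, Differentiable ℂ (iteratedDeriv j G) := fun j =>
    hG.differentiable_iteratedDeriv j (WithTop.coe_lt_top (j : ℕ∞))
  induction k with
  | zero =>
    rw [iteratedDeriv_one]
    funext z
    have h0 : HasDerivAt G (deriv G z) z := by
      have := (hd 0) z
      rw [iteratedDeriv_zero] at this
      exact this.hasDerivAt
    have h1 : HasDerivAt (fun z => c + (z - a) * G z) (1 * G z + (z - a) * deriv G z) z :=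
      ((((hasDerivAt_id z).sub_const a).mul h0)).const_add c
    rw [h1.deriv]
    simp [iteratedDeriv_one]
  | succ k ih =>
    rw [iteratedDeriv_succ, ih]
    funext z
    have h0 : HasDerivAt (iteratedDeriv k G) (iteratedDeriv (k+1) G z) z := by
      rw [iteratedDeriv_succ]; exact (hd k z).hasDerivAt
    have h1 : HasDerivAt (iteratedDeriv (k+1) G) (iteratedDeriv (k+1+1) G z) z := by
      rw [iteratedDeriv_succ (n := k+1)]; exact (hd (k+1) z).hasDerivAt
    have h2 := (h0.const_mul (k + 1 : ℂ)).add (((hasDerivAt_id z).sub_const a).mul h1)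
    have h3 := h2.deriv
    simp only [id] at h3
    refine Eq.trans ?_ (h3.trans ?_)
    · rfl
    · push_cast; ring

lemma bk_schwarz (h : ℕ) (R X K : ℝ) (hR : (h : ℝ) < R) (hX : 0 ≤ X) (x : ℂ)
    (hxR : ‖x‖ ≤ R) (hxa : ∀ s : ℕ, s < h → ‖x - s‖ ≤ X) (n : ℕ) :
    ∀ (F : ℂ → ℂ) (d : ℕ → ℕ) (B η : ℝ), Differentiable ℂ F →
      (∀ z, ‖z‖ ≤ R → ‖F z‖ ≤ B) →
      (∑ s ∈ Finset.range h, d s = n) → (∀ s, ((d s : ℝ) + 1) ≤ K) → 0 ≤ η →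
      (∀ s < h, ∀ k < d s, ‖iteratedDeriv k F s‖ ≤ η * (k.factorial : ℝ)) →
      ‖F x‖ ≤ η * (X * K + 1) ^ n + (2 * X / (R - h)) ^ n * B := by
  induction n with
  | zero =>
    intro F d B η _ hB _ _ hη _
    have := hB x hxR
    simp only [pow_zero, mul_one, one_mul]; linarith
  | succ n ih =>
    intro F d B η hF hB hsum hK hη hder
    have hR0 : 0 < R - h := by linarith
    have hRh : (0:ℝ) ≤ h := Nat.cast_nonneg h
    obtain ⟨a, ha, hda⟩ : ∃ a ∈ Finset.range h, 0 < d a := by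
      by_contra hcon
      push Not at hcon
      have : ∑ s ∈ Finset.range h, d s = 0 := Finset.sum_eq_zero (fun s hs => by
        have := hcon s hs; omega)
      omega
    have hah : a < h := Finset.mem_range.1 ha
    have hahR : (a : ℝ) < h := by exact_mod_cast hah
    set G := dslope F (a : ℂ) with hGdef
    have hGd : Differentiable ℂ G := by
      have := (Complex.differentiableOn_dslope (f := F) (s := Set.univ) (c := (a:ℂ)) Filter.univ_mem).2
        hF.differentiableOn
      exact differentiableOn_univ.1 this
    have hGc : ContDiff ℂ ⊤ G := hGd.contDiff
    have hFG : ∀ z, F z = F a + (z - a) * G z := by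
      intro z
      have := sub_smul_dslope F (a:ℂ) z
      rw [smul_eq_mul] at this
      rw [hGdef, this]; ring
    have hFG' : F = fun z => F a + (z - a) * G z := funext hFG
    have hFa : ‖F a‖ ≤ η := by
      have := hder a hah 0 hda
      simpa [iteratedDeriv_zero] using this
    have hFaB : ‖F a‖ ≤ B := hB a (by
      rw [Complex.norm_natCast]; linarith)
    -- bound of G
    have hGB : ∀ z, ‖z‖ ≤ R → ‖G z‖ ≤ 2 * B / (R - h) := by
      intro z hz
      have hRne : R ≠ 0 := by linarith
      have hcl : z ∈ closure (Metric.ball (0:ℂ) R) := by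
        rw [closure_ball _ hRne]; simpa using hz
      refine Complex.norm_le_of_forall_mem_frontier_norm_le Metric.isBounded_ball
        hGd.diffContOnCl ?_ hcl
      intro w hw
      rw [frontier_ball _ hRne] at hw
      have hw' : ‖w‖ = R := by simpa using hw
      have hwa : R - h ≤ ‖w - a‖ := by
        have := norm_sub_norm_le w (a:ℂ)
        rw [Complex.norm_natCast] at this
        linarith
      have hw1 : ‖F w‖ ≤ B := hB w hw'.le
      have h1 : (w - a) * G w = F w - F a := by rw [hFG w]; ring
      have h2 : ‖w - a‖ * ‖G w‖ ≤ 2 * B := by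
        rw [← norm_mul, h1]
        calc _ ≤ ‖F w‖ + ‖F a‖ := norm_sub_le _ _
          _ ≤ _ := by linarith
      rw [le_div_iff₀ hR0]
      calc ‖G w‖ * (R - h) ≤ ‖G w‖ * ‖w - a‖ := by gcongr
        _ ≤ 2 * B := by linarith
    let d' : ℕ → ℕ := Function.update d a (d a - 1)
    have hd'le : ∀ s, d' s ≤ d s := by
      intro s
      by_cases hs : s = a
      · subst hs; simp [d']
      · simp [d', hs]
    have hsum' : ∑ s ∈ Finset.range h, d' s = n := by
      have e1 := Finset.sum_update_of_mem ha d (d a - 1)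
      have e2 := Finset.add_sum_erase (Finset.range h) d ha
      rw [Finset.sdiff_singleton_eq_erase] at e1
      change ∑ s ∈ Finset.range h, Function.update d a (d a - 1) s = n
      omega
    have hK1 : 1 ≤ K := by
      have := hK a
      have : (0:ℝ) ≤ d a := Nat.cast_nonneg _
      linarith [hK a]
    have key : ∀ s < h, s ≠ a → ∀ k < d s, ‖iteratedDeriv k G s‖ ≤
        (k + 2) * η * (k.factorial : ℝ) := by
      intro s hs hsa k
      have hsa1 : (1:ℝ) ≤ ‖(s:ℂ) - a‖ := by
        have : ((s:ℂ) - a) = (((s:ℤ) - a : ℤ) : ℂ) := by push_cast; ring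
        rw [this, Complex.norm_intCast]
        have h0 : (s:ℤ) - a ≠ 0 := by omega
        exact_mod_cast Int.one_le_abs h0
      induction k with
      | zero =>
        intro hk
        have h0 := hder s hs 0 hk
        simp only [iteratedDeriv_zero, Nat.factorial_zero, Nat.cast_one, mul_one] at h0 ⊢
        have h1 : ((s:ℂ) - a) * G s = F s - F a := by rw [hFG s]; ring
        have h2 : ‖(s:ℂ) - a‖ * ‖G s‖ ≤ 2 * η := by
          rw [← norm_mul, h1]
          calc _ ≤ ‖F s‖ + ‖F a‖ := norm_sub_le _ _
            _ ≤ _ := by linarith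
        have h3 : 1 * ‖G s‖ ≤ ‖(s:ℂ) - a‖ * ‖G s‖ := by gcongr
        simp only [Nat.cast_zero, zero_add]
        linarith
      | succ k ihk =>
        intro hk
        have i1 := ihk (by omega)
        have i2 := hder s hs (k+1) hk
        have i3 : iteratedDeriv (k+1) F s = (k + 1 : ℂ) * iteratedDeriv k G s +
            ((s:ℂ) - a) * iteratedDeriv (k + 1) G s := by
          conv_lhs => rw [hFG']
          rw [bk_iter_leibniz G hGc]
        have i4 : ((s:ℂ) - a) * iteratedDeriv (k + 1) G s =
            iteratedDeriv (k+1) F s - (k + 1 : ℂ) * iteratedDeriv k G s := by rw [i3]; ring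
        have i5 : ‖(s:ℂ) - a‖ * ‖iteratedDeriv (k + 1) G s‖ ≤
            η * ((k+1).factorial : ℝ) + (k+1) * ((k + 2) * η * (k.factorial : ℝ)) := by
          rw [← norm_mul, i4]
          refine (norm_sub_le _ _).trans (add_le_add i2 ?_)
          rw [norm_mul]
          have : ‖(k + 1 : ℂ)‖ = (k + 1 : ℝ) := by
            have := Complex.norm_natCast (k+1)
            push_cast at this; exact this
          rw [this]
          gcongr
        have i6 : 1 * ‖iteratedDeriv (k + 1) G s‖ ≤ ‖(s:ℂ) - a‖ * ‖iteratedDeriv (k + 1) G s‖ := by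
          gcongr
        rw [Nat.factorial_succ] at i5 ⊢
        push_cast at i5 ⊢
        nlinarith [i5, i6]
    have hder' : ∀ s < h, ∀ k < d' s, ‖iteratedDeriv k G s‖ ≤ (K * η) * (k.factorial : ℝ) := by
      intro s hs k hk
      by_cases hsa : s = a
      · subst hsa
        have hk' : k + 1 < d s := by simp [d'] at hk; omega
        have i2 := hder s hs (k+1) hk'
        have i3 : iteratedDeriv (k+1) F s = (k + 1 : ℂ) * iteratedDeriv k G s := by
          conv_lhs => rw [hFG']
          rw [bk_iter_leibniz G hGc]
          simp
        rw [i3, norm_mul] at i2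
        have : ‖(k + 1 : ℂ)‖ = (k + 1 : ℝ) := by
          have := Complex.norm_natCast (k+1)
          push_cast at this; exact this
        rw [this, Nat.factorial_succ] at i2
        push_cast at i2
        have hk0 : (0:ℝ) < k + 1 := by positivity
        have : ‖iteratedDeriv k G s‖ ≤ η * (k.factorial : ℝ) := by
          have : (k+1:ℝ) * ‖iteratedDeriv k G s‖ ≤ (k+1) * (η * (k.factorial : ℝ)) := by linarith
          exact le_of_mul_le_mul_left this hk0
        refine this.trans ?_
        gcongr
        nlinarith
      · have hk' : k < d s := by simpa [d', hsa] using hk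
        refine (key s hs hsa k hk').trans ?_
        gcongr
        have h1 := hK s
        have h2 : (k:ℝ) + 1 ≤ d s := by exact_mod_cast hk'
        linarith
    have hfin := ih G d' (2 * B / (R - h)) (K * η) hGd hGB hsum'
      (fun s => by
        have h1 := hK s
        have h2 : (d' s : ℝ) ≤ d s := by exact_mod_cast hd'le s
        linarith) (by positivity) hder'
    have hx1 := hxa a hah
    have hXK : 0 ≤ X * K := by positivity
    have hpow : 1 ≤ (X * K + 1) ^ n := one_le_pow₀ (by linarith)
    calc ‖F x‖ = ‖F a + (x - a) * G x‖ := by rw [← hFG x]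
      _ ≤ ‖F a‖ + ‖x - a‖ * ‖G x‖ := by
        rw [← norm_mul]; exact norm_add_le _ _
      _ ≤ η + X * (K * η * (X * K + 1) ^ n + (2 * X / (R - h)) ^ n * (2 * B / (R - h))) := by
        gcongr
      _ = (η * (1 + X * K * (X * K + 1) ^ n)) + (2 * X / (R - h)) ^ (n+1) * B := by
        rw [pow_succ]; ring
      _ ≤ η * (X * K + 1) ^ (n+1) + (2 * X / (R - h)) ^ (n+1) * B := by
        gcongr
        rw [pow_succ]
        nlinarith


/-! ### The real and complex roots of x^3 = x + 1 -/

lemma pr_exists : ∃ r : ℝ, 1.324 < r ∧ r < 1.325 ∧ r ^ 3 = r + 1 := by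
  have hc : ContinuousOn (fun x : ℝ => x ^ 3 - x - 1) (Set.Icc 1.324 1.325) := by fun_prop
  have := intermediate_value_Ioo (by norm_num : (1.324 : ℝ) ≤ 1.325) hc
  have h0 : (0 : ℝ) ∈ Set.Ioo ((1.324 : ℝ) ^ 3 - 1.324 - 1) ((1.325 : ℝ) ^ 3 - 1.325 - 1) := by
    constructor <;> norm_num
  obtain ⟨r, hr, h⟩ := this h0
  exact ⟨r, hr.1, hr.2, by simp only at h; linarith⟩

/-- the plastic number -/
noncomputable def pr : ℝ := Classical.choose pr_exists

lemma pr_lb : 1.324 < pr := (Classical.choose_spec pr_exists).1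
lemma pr_ub : pr < 1.325 := (Classical.choose_spec pr_exists).2.1
lemma pr_cube : pr ^ 3 = pr + 1 := (Classical.choose_spec pr_exists).2.2
lemma pr_pos : 0 < pr := by linarith [pr_lb]

/-- the complex conjugate root -/
noncomputable def ps : ℂ := ⟨-pr / 2, Real.sqrt (3 * pr ^ 2 - 4) / 2⟩

lemma ps_sqrt : Real.sqrt (3 * pr ^ 2 - 4) ^ 2 = 3 * pr ^ 2 - 4 :=
  Real.sq_sqrt (by nlinarith [pr_lb])

/-- σ satisfies x^2 + ρ x + (ρ^2-1) = 0 -/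
lemma ps_quad : ps ^ 2 = -(pr : ℂ) * ps - ((pr : ℂ) ^ 2 - 1) := by
  have h := ps_sqrt
  apply Complex.ext
  · simp [ps, pow_two] at h ⊢
    nlinarith
  · simp [ps, pow_two] at h ⊢
    ring

lemma pr_cubeC : (pr : ℂ) ^ 3 = pr + 1 := by exact_mod_cast pr_cube

lemma ps_cube : ps ^ 3 = ps + 1 := by
  have h1 := ps_quad
  have h2 := pr_cubeC
  linear_combination (ps - pr) * h1 + h2

/-- norm form -/
lemma ps_norm (a b c : ℝ) : ‖(a : ℂ) + b * ps + c * ps ^ 2‖ ^ 2 =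
    a^2 - a*b*pr + a*c*(2-pr^2) + b^2*(pr^2-1) - b*c*pr*(pr^2-1) + c^2*(pr^2-1)^2 := by
  rw [ps_quad, ← Complex.normSq_eq_norm_sq, Complex.normSq_apply]
  have h := ps_sqrt
  set t := Real.sqrt (3 * pr ^ 2 - 4) with ht
  have e1 : ((a : ℂ) + b * ps + c * (-(pr : ℂ) * ps - ((pr : ℂ) ^ 2 - 1))).re
      = a - b * pr / 2 + c * (pr ^ 2 / 2 - pr ^ 2 + 1) := by
    simp [ps, pow_two]; ring
  have e2 : ((a : ℂ) + b * ps + c * (-(pr : ℂ) * ps - ((pr : ℂ) ^ 2 - 1))).im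
      = (b - c * pr) * t / 2 := by
    have e3 : ps.im = t / 2 := by simp [ps, ht]
    have e4 : ((pr : ℂ) ^ 2).im = 0 := by simp [pow_two]
    simp [e3, e4]; ring
  rw [e1, e2]
  linear_combination ((b - c * pr)^2/4) * h

lemma norm_form_id (a b c : ℝ) : (a + b * pr + c * pr ^ 2) *
    (a^2 - a*b*pr + a*c*(2-pr^2) + b^2*(pr^2-1) - b*c*pr*(pr^2-1) + c^2*(pr^2-1)^2) =
    a^3+2*a^2*c-a*b^2+a*c^2-3*a*b*c+b^3-b*c^2+c^3 := by
  have h := pr_cube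
  linear_combination (c^3*pr^3 - c^3*pr - 3*a*b*c + b^3 - b*c^2 + c^3) * h


/-- the integral norm form -/
def nmf (a b c : ℤ) : ℤ := a^3+2*a^2*c-a*b^2+a*c^2-3*a*b*c+b^3-b*c^2+c^3

lemma nmf_even (a b c : ℤ) (h : nmf a b c = 0) : 2 ∣ a ∧ 2 ∣ b ∧ 2 ∣ c := by
  have h2 : ((nmf a b c : ℤ) : ZMod 2) = 0 := by rw [h]; simp
  unfold nmf at h2
  push_cast at h2
  have key : ∀ x y z : ZMod 2, x^3+2*x^2*z-x*y^2+x*z^2-3*x*y*z+y^3-y*z^2+z^3 = 0 →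
      x = 0 ∧ y = 0 ∧ z = 0 := by decide
  obtain ⟨h3, h4, h5⟩ := key _ _ _ h2
  exact ⟨(ZMod.intCast_zmod_eq_zero_iff_dvd a 2).1 h3, (ZMod.intCast_zmod_eq_zero_iff_dvd b 2).1 h4,
    (ZMod.intCast_zmod_eq_zero_iff_dvd c 2).1 h5⟩

lemma nmf_zero_aux (n : ℕ) : ∀ a b c : ℤ, a.natAbs + b.natAbs + c.natAbs ≤ n → nmf a b c = 0 →
    a = 0 ∧ b = 0 ∧ c = 0 := by
  induction n with
  | zero => intro a b c h _; omega
  | succ n ih =>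
    intro a b c h h0
    obtain ⟨⟨x, rfl⟩, ⟨y, rfl⟩, ⟨z, rfl⟩⟩ := nmf_even a b c h0
    have h1 : nmf x y z = 0 := by
      have : nmf (2*x) (2*y) (2*z) = 8 * nmf x y z := by unfold nmf; ring
      omega
    by_cases hz : x.natAbs + y.natAbs + z.natAbs ≤ n
    · have := ih x y z hz h1
      omega
    · omega

lemma nmf_zero (a b c : ℤ) (h : nmf a b c = 0) : a = 0 ∧ b = 0 ∧ c = 0 :=
  nmf_zero_aux _ a b c le_rfl h

/-- `x ∈ ℤ[ρ]` and `y` is its image under the complex embedding `ρ ↦ σ`. -/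
def Cj (x : ℝ) (y : ℂ) : Prop :=
  ∃ a b c : ℤ, x = a + b * pr + c * pr ^ 2 ∧ y = a + b * ps + c * ps ^ 2

lemma Cj_norm {a b c : ℤ} {x : ℝ} {y : ℂ} (hx : x = a + b * pr + c * pr ^ 2)
    (hy : y = a + b * ps + c * ps ^ 2) : x * ‖y‖ ^ 2 = (nmf a b c : ℤ) := by
  have h1 := ps_norm a b c
  have h2 := norm_form_id a b c
  push_cast at h1
  rw [hy, h1, hx, h2]
  unfold nmf
  push_cast
  ring

lemma Cj.liouville {x : ℝ} {y : ℂ} (h : Cj x y) (hx : x ≠ 0) : 1 ≤ |x| * ‖y‖ ^ 2 := by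
  obtain ⟨a, b, c, h1, h2⟩ := h
  have h3 := Cj_norm h1 h2
  have h4 : nmf a b c ≠ 0 := by
    intro h0
    obtain ⟨rfl, rfl, rfl⟩ := nmf_zero a b c h0
    simp at h1; exact hx h1
  have h5 : |x| * ‖y‖ ^ 2 = |((nmf a b c : ℤ) : ℝ)| := by
    rw [← h3, abs_mul, abs_of_nonneg (sq_nonneg ‖y‖)]
  rw [h5]
  exact_mod_cast Int.one_le_abs h4

lemma Cj.intNorm {x : ℝ} {y : ℂ} (h : Cj x y) : ∃ k : ℤ, x * ‖y‖ ^ 2 = k := by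
  obtain ⟨a, b, c, h1, h2⟩ := h
  exact ⟨_, Cj_norm h1 h2⟩

lemma Cj.zero_right {x : ℝ} {y : ℂ} (h : Cj x y) (hx : x = 0) : y = 0 := by
  obtain ⟨a, b, c, h1, h2⟩ := h
  have h3 := Cj_norm h1 h2
  rw [hx, zero_mul] at h3
  obtain ⟨rfl, rfl, rfl⟩ := nmf_zero a b c (by exact_mod_cast h3.symm)
  simp [h2]

lemma Cj.int (k : ℤ) : Cj k k := ⟨k, 0, 0, by simp, by simp⟩
lemma Cj.nat (k : ℕ) : Cj k k := ⟨k, 0, 0, by simp, by simp⟩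
lemma Cj.root : Cj pr ps := ⟨0, 1, 0, by simp, by simp⟩
lemma Cj.add {x x' : ℝ} {y y' : ℂ} (h : Cj x y) (h' : Cj x' y') : Cj (x + x') (y + y') := by
  obtain ⟨a, b, c, h1, h2⟩ := h
  obtain ⟨a', b', c', h1', h2'⟩ := h'
  exact ⟨a + a', b + b', c + c', by rw [h1, h1']; push_cast; ring, by rw [h2, h2']; push_cast; ring⟩
lemma Cj.mul {x x' : ℝ} {y y' : ℂ} (h : Cj x y) (h' : Cj x' y') : Cj (x * x') (y * y') := by
  obtain ⟨a, b, c, h1, h2⟩ := h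
  obtain ⟨a', b', c', h1', h2'⟩ := h'
  refine ⟨a * a' + b * c' + c * b', a * b' + b * a' + b * c' + c * b' + c * c',
    a * c' + b * b' + c * a' + c * c', ?_, ?_⟩
  · rw [h1, h1']; push_cast
    linear_combination ((b:ℝ) * c' + c * b' + c * c' * pr) * pr_cube
  · rw [h2, h2']; push_cast
    linear_combination ((b:ℂ) * c' + c * b' + c * c' * ps) * ps_cube
lemma Cj.pow {x : ℝ} {y : ℂ} (h : Cj x y) (n : ℕ) : Cj (x ^ n) (y ^ n) := by
  induction n with
  | zero => simpa using Cj.nat 1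
  | succ n ih => rw [pow_succ, pow_succ]; exact ih.mul h
lemma Cj.sum {ι : Type*} (s : Finset ι) (f : ι → ℝ) (g : ι → ℂ) (h : ∀ i ∈ s, Cj (f i) (g i)) :
    Cj (∑ i ∈ s, f i) (∑ i ∈ s, g i) := by
  classical
  induction s using Finset.induction_on with
  | empty => simpa using Cj.nat 0
  | insert a s ha ih =>
    rw [Finset.sum_insert ha, Finset.sum_insert ha]
    exact (h a (by simp)).add (ih fun i hi => h i (by simp [hi]))

lemma Cj.unique {x : ℝ} {y y' : ℂ} (h : Cj x y) (h' : Cj x y') : y = y' := by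
  have h2 := (h.add ((Cj.int (-1)).mul h')).zero_right (by push_cast; ring)
  push_cast at h2
  linear_combination h2

/-- β = 3ρ²-1 -/
noncomputable def pb : ℝ := 3 * pr ^ 2 - 1
noncomputable def pbs : ℂ := 3 * ps ^ 2 - 1

lemma Cj_pb : Cj pb pbs := ⟨-1, 0, 3, by unfold pb; push_cast; ring, by unfold pbs; push_cast; ring⟩

lemma pb_norm : pb * ‖pbs‖ ^ 2 = 23 := by
  have := Cj_norm (a := -1) (b := 0) (c := 3) (x := pb) (y := pbs)
    (by unfold pb; push_cast; ring) (by unfold pbs; push_cast; ring)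
  rw [this]; norm_num [nmf]

lemma pr_norm : pr * ‖ps‖ ^ 2 = 1 := by
  have := Cj_norm (a := 0) (b := 1) (c := 0) (x := pr) (y := ps) (by simp) (by simp)
  rw [this]; norm_num [nmf]

lemma pb_lb : 4.2 < pb := by unfold pb; nlinarith [pr_lb]
lemma pb_ub : pb < 4.27 := by unfold pb; nlinarith [pr_ub, pr_lb]

lemma pbs_norm_le : ‖pbs‖ ≤ 2.35 := by
  have h := pb_norm
  have h1 := pb_lb
  by_contra hc
  push Not at hc
  nlinarith [mul_pos (sub_pos.2 h1) (by positivity : 0 < ‖pbs‖ ^2), sq_nonneg (‖pbs‖)]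

lemma ps_norm_le : ‖ps‖ ≤ 1 := by
  have h := pr_norm
  have h1 := pr_lb
  by_contra hc
  push Not at hc
  nlinarith [norm_nonneg ps]

/-- multiplicative independence of ρ, 10, dβ/9 -/
lemma mul_indep (d : ℕ) (hd : 0 < d) (hd9 : d ≤ 9) (a b c a' b' c' : ℕ)
    (h : pr ^ a * 10 ^ b * (d * pb / 9) ^ c = pr ^ a' * 10 ^ b' * (d * pb / 9) ^ c') :
    a = a' ∧ b = b' ∧ c = c' := by
  have e1 : ∀ a b c c' : ℕ, Cj (pr ^ a * 10 ^ b * (d * pb) ^ c * 9 ^ c')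
      (ps ^ a * 10 ^ b * (d * pbs) ^ c * 9 ^ c') := fun a b c c' =>
    (((Cj.root.pow a).mul (by simpa using (Cj.nat 10).pow b)).mul
      (((Cj.nat d).mul Cj_pb).pow c)).mul (by simpa using (Cj.nat 9).pow c')
  have h2 : pr ^ a * 10 ^ b * (d * pb) ^ c * 9 ^ c' =
      pr ^ a' * 10 ^ b' * (d * pb) ^ c' * 9 ^ c := by
    rw [div_pow, div_pow] at h
    field_simp at h
    linarith
  have h3 := Cj.unique (e1 a b c c') (by rw [h2]; exact e1 a' b' c' c)
  have nm : ∀ a b c c' : ℕ, (pr ^ a * 10 ^ b * (d * pb) ^ c * 9 ^ c') *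
      ‖ps ^ a * 10 ^ b * (d * pbs) ^ c * 9 ^ c'‖ ^ 2 =
      ((1000 ^ b * (23 * d ^ 3) ^ c * 729 ^ c' : ℕ) : ℝ) := by
    intro a b c c'
    have : (pr ^ a * 10 ^ b * (d * pb) ^ c * 9 ^ c') *
      ‖ps ^ a * 10 ^ b * (d * pbs) ^ c * 9 ^ c'‖ ^ 2 = (pr * ‖ps‖ ^ 2) ^ a * (10 * 10 ^ 2) ^ b *
        (d ^ 3 * (pb * ‖pbs‖ ^ 2)) ^ c * (9 * 9 ^ 2) ^ c' := by
      simp only [norm_mul, norm_pow, Complex.norm_natCast, Complex.norm_ofNat]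
      simp only [mul_pow, ← pow_mul, mul_comm _ 2]
      ring
    rw [this, pr_norm, pb_norm]
    push_cast
    rw [one_pow]
    norm_num
    ring
  have h4 : 1000 ^ b * (23 * d ^ 3) ^ c * 729 ^ c' = 1000 ^ b' * (23 * d ^ 3) ^ c' * 729 ^ c := by
    have := nm a b c c'
    rw [h2, h3, nm a' b' c' c] at this
    exact_mod_cast this.symm
  have val : ∀ b c c' : ℕ, padicValNat 23 (1000 ^ b * (23 * d ^ 3) ^ c * 729 ^ c') = c := by
    intro b c c'
    have : Fact (Nat.Prime 23) := ⟨by norm_num⟩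
    have hd' : padicValNat 23 d = 0 := padicValNat.eq_zero_of_not_dvd (by
      intro h; have := Nat.le_of_dvd hd h; omega)
    have h1 : padicValNat 23 1000 = 0 := padicValNat.eq_zero_of_not_dvd (by norm_num)
    have h2 : padicValNat 23 729 = 0 := padicValNat.eq_zero_of_not_dvd (by norm_num)
    have hd0 : d ≠ 0 := by omega
    rw [padicValNat.mul (by positivity) (by positivity), padicValNat.mul (by positivity) (by positivity),
      padicValNat.pow, padicValNat.pow, padicValNat.pow,
      padicValNat.mul (by positivity) (by positivity), padicValNat.pow, padicValNat_self, h1, h2, hd']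
    simp
  have hc : c = c' := by rw [← val b c c', h4, val]
  subst hc
  have hb : b = b' := by
    have h5 : 1000 ^ b = 1000 ^ b' := by
      have p1 : 0 < (23 * d ^ 3) ^ c := by positivity
      have p2 : 0 < 729 ^ c := by positivity
      exact Nat.eq_of_mul_eq_mul_right p1 (Nat.eq_of_mul_eq_mul_right p2 h4)
    exact Nat.pow_right_injective (by norm_num) h5
  subst hb
  refine ⟨?_, rfl, rfl⟩
  have hp := pb_lb
  have hd0 : (0 : ℝ) < d := by exact_mod_cast hd
  have p1 : (0:ℝ) < (d * pb / 9) ^ c := by positivity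
  have h6 := mul_right_cancel₀ (by positivity) (mul_right_cancel₀ p1.ne' h)
  exact pow_right_injective₀ pr_pos (by linarith [pr_lb]) h6


/-! ### The auxiliary function -/

/-- The auxiliary exponential polynomial. -/
noncomputable def bF {ι : Type} [Fintype ι] (p x y : ι → ℝ) (u v : ℝ) (j k : ℕ) (z : ℂ) : ℂ :=
  ∑ i, ((p i * x i ^ j * y i ^ k : ℝ) : ℂ) * Complex.exp (((x i * u + y i * v : ℝ) : ℂ) * z)

lemma bF_hasDeriv {ι : Type} [Fintype ι] (p x y : ι → ℝ) (u v : ℝ) (j k : ℕ) (z : ℂ) :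
    HasDerivAt (bF p x y u v j k)
      (u * bF p x y u v (j + 1) k z + v * bF p x y u v j (k + 1) z) z := by
  have h : ∀ i ∈ (Finset.univ : Finset ι), HasDerivAt (fun z : ℂ =>
      ((p i * x i ^ j * y i ^ k : ℝ) : ℂ) * Complex.exp (((x i * u + y i * v : ℝ) : ℂ) * z))
      (((p i * x i ^ j * y i ^ k : ℝ) : ℂ) * (Complex.exp (((x i * u + y i * v : ℝ) : ℂ) * z) *
        (((x i * u + y i * v : ℝ) : ℂ) * 1))) z := by
    intro i _
    exact (((hasDerivAt_id z).const_mul _).cexp).const_mul _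
  have h2 := HasDerivAt.fun_sum h
  refine h2.congr_deriv ?_
  unfold bF
  rw [Finset.mul_sum, Finset.mul_sum, ← Finset.sum_add_distrib]
  refine Finset.sum_congr rfl fun i _ => ?_
  push_cast
  ring

lemma bF_diff {ι : Type} [Fintype ι] (p x y : ι → ℝ) (u v : ℝ) (j k : ℕ) :
    Differentiable ℂ (bF p x y u v j k) := fun z => (bF_hasDeriv p x y u v j k z).differentiableAt

lemma bF_iter {ι : Type} [Fintype ι] (p x y : ι → ℝ) (u v : ℝ) (huv : |u| + |v| ≤ 3) (M : ℕ)
    (s : ℂ) (ε : ℝ) (hb : ∀ j k, j + k < M → ‖bF p x y u v j k s‖ ≤ ε) (t : ℕ) :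
    ∀ j k, j + k + t < M → ‖iteratedDeriv t (bF p x y u v j k) s‖ ≤ 3 ^ t * ε := by
  induction t with
  | zero => intro j k h; simpa using hb j k (by omega)
  | succ t ih =>
    intro j k h
    have hd : deriv (bF p x y u v j k) =
        (u : ℂ) • bF p x y u v (j + 1) k + (v : ℂ) • bF p x y u v j (k + 1) := by
      funext z
      rw [(bF_hasDeriv p x y u v j k z).deriv]
      simp
    have c1 : ContDiffAt ℂ t (bF p x y u v (j + 1) k) s := (bF_diff p x y u v _ _).contDiff.contDiffAt
    have c2 : ContDiffAt ℂ t (bF p x y u v j (k + 1)) s := (bF_diff p x y u v _ _).contDiff.contDiffAt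
    have c3 : ContDiffAt ℂ t ((u : ℂ) • bF p x y u v (j + 1) k) s := c1.const_smul (u : ℂ)
    have c4 : ContDiffAt ℂ t ((v : ℂ) • bF p x y u v j (k + 1)) s := c2.const_smul (v : ℂ)
    rw [iteratedDeriv_succ', hd, iteratedDeriv_add c3 c4,
      iteratedDeriv_const_smul c1, iteratedDeriv_const_smul c2]
    have h1 := ih (j + 1) k (by omega)
    have h2 := ih j (k + 1) (by omega)
    have h0 : 0 ≤ 3 ^ t * ε := le_trans (norm_nonneg _) h1
    calc _ ≤ |u| * (3 ^ t * ε) + |v| * (3 ^ t * ε) := by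
          refine (norm_add_le _ _).trans (add_le_add ?_ ?_)
          · rw [norm_smul, Complex.norm_real, Real.norm_eq_abs]
            exact mul_le_mul_of_nonneg_left h1 (abs_nonneg _)
          · rw [norm_smul, Complex.norm_real, Real.norm_eq_abs]
            exact mul_le_mul_of_nonneg_left h2 (abs_nonneg _)
      _ = (|u| + |v|) * (3 ^ t * ε) := by ring
      _ ≤ 3 * (3 ^ t * ε) := mul_le_mul_of_nonneg_right huv h0
      _ = _ := by ring

lemma bF_growth {ι : Type} [Fintype ι] (p x y : ι → ℝ) (u v : ℝ) (P A W : ℝ)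
    (hp : ∀ i, |p i| ≤ P) (hA : 1 ≤ A) (hx : ∀ i, |x i| ≤ A) (hy : ∀ i, |y i| ≤ A)
    (hw : ∀ i, |x i * u + y i * v| ≤ W) (hP : 0 ≤ P) (j k M : ℕ) (hM : j + k ≤ M) (z : ℂ) :
    ‖bF p x y u v j k z‖ ≤ (Fintype.card ι * P * A ^ M) * Real.exp (W * ‖z‖) := by
  unfold bF
  have hb : ∀ i ∈ (Finset.univ : Finset ι), ‖((p i * x i ^ j * y i ^ k : ℝ) : ℂ) *
      Complex.exp (((x i * u + y i * v : ℝ) : ℂ) * z)‖ ≤ P * A ^ M * Real.exp (W * ‖z‖) := by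
    intro i _
    rw [norm_mul, Complex.norm_real, Real.norm_eq_abs, abs_mul, abs_mul, abs_pow, abs_pow]
    have h1 : |p i| * |x i| ^ j * |y i| ^ k ≤ P * A ^ M := by
      calc |p i| * |x i| ^ j * |y i| ^ k ≤ P * A ^ j * A ^ k := by
            gcongr
            · exact hp i
            · exact hx i
            · exact hy i
        _ = P * A ^ (j + k) := by ring
        _ ≤ P * A ^ M := by gcongr
    have h2 : ‖Complex.exp (((x i * u + y i * v : ℝ) : ℂ) * z)‖ ≤ Real.exp (W * ‖z‖) := by
      refine (Complex.norm_exp_le_exp_norm _).trans (Real.exp_le_exp.2 ?_)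
      rw [norm_mul, Complex.norm_real, Real.norm_eq_abs]
      exact mul_le_mul_of_nonneg_right (hw i) (norm_nonneg _)
    exact mul_le_mul h1 h2 (norm_nonneg _) (by positivity)
  refine (norm_sum_le_of_le _ hb).trans (le_of_eq ?_)
  rw [Finset.sum_const, nsmul_eq_mul, Finset.card_univ]
  ring

/-- Extrapolation for the auxiliary function. -/
lemma bF_extra {ι : Type} [Fintype ι] (p x y : ι → ℝ) (u v : ℝ) (huv : |u| + |v| ≤ 3) (P A W : ℝ)
    (hp : ∀ i, |p i| ≤ P) (hA : 1 ≤ A) (hx : ∀ i, |x i| ≤ A) (hy : ∀ i, |y i| ≤ A)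
    (hw : ∀ i, |x i * u + y i * v| ≤ W) (hP : 0 ≤ P) (hW : 0 ≤ W)
    (M M' D h h' : ℕ) (hM : M' + D ≤ M) (hh : h ≤ h') (hpos : 0 < h') (ε : ℝ) (hε : 0 ≤ ε)
    (hb : ∀ j k s : ℕ, j + k < M → s < h → ‖bF p x y u v j k s‖ ≤ ε)
    (j k s : ℕ) (hjk : j + k < M') (hs : s < h') :
    ‖bF p x y u v j k s‖ ≤ 3 ^ D * ε * (h' * (D + 1) + 1 : ℝ) ^ (D * h) +
      (1 / 4) ^ (D * h) * ((Fintype.card ι * P * A ^ M') * Real.exp (W * (9 * h'))) := by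
  have hh' : (h : ℝ) ≤ h' := by exact_mod_cast hh
  have hpos' : (0 : ℝ) < h' := by exact_mod_cast hpos
  have hs' : (s : ℝ) < h' := by exact_mod_cast hs
  have key := bk_schwarz h (9 * h') h' (D + 1) (by linarith) hpos'.le (s : ℂ)
    (by rw [Complex.norm_natCast]; linarith) (by
      intro t ht
      have ht' : (t : ℝ) < h' := by exact_mod_cast (by omega : t < h')
      have : ((s : ℂ) - t) = ((s - t : ℝ) : ℂ) := by push_cast; ring
      rw [this, Complex.norm_real, Real.norm_eq_abs, abs_le]
      constructor <;> linarith [(Nat.cast_nonneg s : (0:ℝ) ≤ s), (Nat.cast_nonneg t : (0:ℝ) ≤ t)])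
    (D * h) (bF p x y u v j k) (fun _ => D)
    ((Fintype.card ι * P * A ^ M') * Real.exp (W * (9 * h'))) (3 ^ D * ε)
    (bF_diff p x y u v j k) (by
      intro z hz
      refine (bF_growth p x y u v P A W hp hA hx hy hw hP j k M' (by omega) z).trans ?_
      gcongr) (by simp [mul_comm]) (fun _ => le_rfl) (by positivity) (by
      intro t ht r hr
      have h1 := bF_iter p x y u v huv M t ε (fun j k h => hb j k t h ht) r j k (by omega)
      refine h1.trans ?_
      have h2 : (3 : ℝ) ^ r ≤ 3 ^ D := pow_le_pow_right₀ (by norm_num) hr.le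
      have h3 : (1 : ℝ) ≤ (r.factorial : ℝ) := by exact_mod_cast Nat.succ_le_of_lt (Nat.factorial_pos r)
      calc 3 ^ r * ε ≤ 3 ^ D * ε := mul_le_mul_of_nonneg_right h2 hε
        _ = 3 ^ D * ε * 1 := by ring
        _ ≤ _ := by gcongr)
  refine key.trans (add_le_add le_rfl ?_)
  refine mul_le_mul_of_nonneg_right ?_ (by positivity)
  refine pow_le_pow_left₀ (div_nonneg (by linarith) (by linarith)) ?_ _
  rw [div_le_div_iff₀ (by linarith) (by norm_num)]
  linarith


/-! ### Arithmetic side -/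

abbrev BI (L : ℕ) := Fin L × Fin L × Fin L

def bg1 (L N : ℕ) (i : BI L) : ℤ := (i.1 : ℕ) + (i.2.2 : ℕ) * (N : ℤ)
def bg2 (L m : ℕ) (i : BI L) : ℤ := (i.2.1 : ℕ) - (i.2.2 : ℕ) * (m : ℤ)

/-- α₃ -/
noncomputable def al3 (d : ℕ) : ℝ := d * pb / 9

noncomputable def bG (L N m d : ℕ) (p : BI L → ℤ) (j k s : ℕ) : ℝ :=
  ∑ i, (p i : ℝ) * (bg1 L N i : ℝ) ^ j * (bg2 L m i : ℝ) ^ k *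
    (pr ^ (i.1 : ℕ) * 10 ^ (i.2.1 : ℕ) * al3 d ^ (i.2.2 : ℕ)) ^ s

lemma bG_liouville (L N m d : ℕ) (hd9 : d ≤ 9) (p : BI L → ℤ) (P A : ℝ)
    (hp : ∀ i, |(p i : ℝ)| ≤ P) (hA : 1 ≤ A) (hx : ∀ i, |(bg1 L N i : ℝ)| ≤ A)
    (hy : ∀ i, |(bg2 L m i : ℝ)| ≤ A) (hP : 0 ≤ P) (j k s M : ℕ) (hM : j + k ≤ M)
    (h0 : bG L N m d p j k s ≠ 0) :
    1 ≤ |bG L N m d p j k s| * 2 ^ (19 * (L * s)) * (Fintype.card (BI L) * P * A ^ M) ^ 2 := by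
  let y : BI L → ℂ := fun i => ((p i : ℤ) : ℂ) * ((bg1 L N i : ℤ) : ℂ) ^ j * ((bg2 L m i : ℤ) : ℂ) ^ k *
    ((ps ^ (i.1 : ℕ)) ^ s * (((10 : ℕ) : ℂ) ^ (i.2.1 : ℕ)) ^ s * ((((d : ℕ) : ℂ) * pbs) ^ (i.2.2 : ℕ)) ^ s *
      (((9 : ℕ) : ℂ) ^ (L - (i.2.2 : ℕ))) ^ s)
  let x : BI L → ℝ := fun i => ((p i : ℤ) : ℝ) * ((bg1 L N i : ℤ) : ℝ) ^ j * ((bg2 L m i : ℤ) : ℝ) ^ k *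
    ((pr ^ (i.1 : ℕ)) ^ s * (((10 : ℕ) : ℝ) ^ (i.2.1 : ℕ)) ^ s * ((((d : ℕ) : ℝ) * pb) ^ (i.2.2 : ℕ)) ^ s *
      (((9 : ℕ) : ℝ) ^ (L - (i.2.2 : ℕ))) ^ s)
  have hC : Cj (∑ i, x i) (∑ i, y i) := by
    refine Cj.sum _ _ _ fun i _ => ?_
    exact ((((Cj.int _).mul ((Cj.int _).pow j)).mul ((Cj.int _).pow k))).mul
      ((((((Cj.root).pow _).pow s).mul (((Cj.nat 10).pow _).pow s)).mul
        ((((Cj.nat d).mul Cj_pb).pow _).pow s)).mul (((Cj.nat 9).pow _).pow s))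
  have hxs : ∑ i, x i = 9 ^ (L * s) * bG L N m d p j k s := by
    unfold bG
    rw [Finset.mul_sum]
    refine Finset.sum_congr rfl fun i _ => ?_
    have h9 : (9 : ℝ) ^ (L * s) = (9 ^ (i.2.2 : ℕ)) ^ s * (9 ^ (L - (i.2.2 : ℕ))) ^ s := by
      rw [← mul_pow, ← pow_add, ← pow_mul]
      congr 2
      have := i.2.2.2
      omega
    simp only [x, al3]
    rw [h9, div_pow, mul_pow (pr ^ (i.1 : ℕ) * 10 ^ (i.2.1 : ℕ)), mul_pow (pr ^ (i.1 : ℕ)), div_pow]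
    push_cast
    field_simp
  have h1 := hC.liouville (by rw [hxs]; positivity)
  have hyb : ‖∑ i, y i‖ ≤ (Fintype.card (BI L) * P * A ^ M) * 212 ^ (L * s) := by
    have hb : ∀ i ∈ (Finset.univ : Finset (BI L)), ‖y i‖ ≤ P * A ^ M * 212 ^ (L * s) := by
      intro i _
      simp only [y, norm_mul, norm_pow, Complex.norm_natCast, Complex.norm_intCast]
      have e1 : |(p i : ℝ)| * |(bg1 L N i : ℝ)| ^ j * |(bg2 L m i : ℝ)| ^ k ≤ P * A ^ M := by
        calc |(p i : ℝ)| * |(bg1 L N i : ℝ)| ^ j * |(bg2 L m i : ℝ)| ^ k ≤ P * A ^ j * A ^ k := by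
              gcongr
              · exact hp i
              · exact hx i
              · exact hy i
          _ = P * A ^ (j + k) := by ring
          _ ≤ P * A ^ M := by gcongr
      have e2 : (‖ps‖ ^ (i.1 : ℕ)) ^ s ≤ 1 :=
        pow_le_one₀ (by positivity) (pow_le_one₀ (norm_nonneg _) ps_norm_le)
      have e3 : (((10 : ℕ) : ℝ) ^ (i.2.1 : ℕ)) ^ s ≤ 10 ^ (L * s) := by
        rw [← pow_mul]
        push_cast
        exact pow_le_pow_right₀ (by norm_num) (Nat.mul_le_mul_right s i.2.1.2.le)
      have hdp : (d : ℝ) * ‖pbs‖ ≤ 21.2 := by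
        have : (d : ℝ) ≤ 9 := by exact_mod_cast hd9
        nlinarith [pbs_norm_le, norm_nonneg pbs]
      have e4 : (((d : ℝ) * ‖pbs‖) ^ (i.2.2 : ℕ)) ^ s * (((9 : ℕ) : ℝ) ^ (L - (i.2.2 : ℕ))) ^ s ≤
          21.2 ^ (L * s) := by
        calc (((d : ℝ) * ‖pbs‖) ^ (i.2.2 : ℕ)) ^ s * (((9 : ℕ) : ℝ) ^ (L - (i.2.2 : ℕ))) ^ s
            ≤ (21.2 ^ (i.2.2 : ℕ)) ^ s * (21.2 ^ (L - (i.2.2 : ℕ))) ^ s := by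
              gcongr
              norm_num
          _ = 21.2 ^ (L * s) := by
              rw [← mul_pow, ← pow_add, ← pow_mul]
              congr 2
              have := i.2.2.2
              omega
      have e5 : (212 : ℝ) ^ (L * s) = 10 ^ (L * s) * 21.2 ^ (L * s) := by
        rw [← mul_pow]; norm_num
      rw [e5]
      refine mul_le_mul e1 ?_ (by positivity) (by positivity)
      calc _ ≤ 1 * 10 ^ (L * s) * ((((d : ℝ) * ‖pbs‖) ^ (i.2.2 : ℕ)) ^ s *
            (((9 : ℕ) : ℝ) ^ (L - (i.2.2 : ℕ))) ^ s) := by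
            rw [mul_assoc]
            gcongr
        _ ≤ 1 * 10 ^ (L * s) * 21.2 ^ (L * s) := by gcongr
        _ = _ := by ring
    refine (norm_sum_le_of_le _ hb).trans (le_of_eq ?_)
    rw [Finset.sum_const, nsmul_eq_mul, Finset.card_univ]
    ring
  have hfin : (9 : ℝ) ^ (L * s) * (212 ^ (L * s)) ^ 2 ≤ 2 ^ (19 * (L * s)) := by
    rw [pow_mul (2 : ℝ), ← pow_mul, mul_comm (L * s) 2, pow_mul (212 : ℝ), ← mul_pow]
    gcongr
    norm_num
  rw [hxs, abs_mul, abs_of_pos (by positivity : (0 : ℝ) < 9 ^ (L * s))] at h1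
  set Q : ℝ := Fintype.card (BI L) * P * A ^ M with hQ
  calc (1 : ℝ) ≤ 9 ^ (L * s) * |bG L N m d p j k s| * ‖∑ i, y i‖ ^ 2 := h1
    _ ≤ 9 ^ (L * s) * |bG L N m d p j k s| * (Q * 212 ^ (L * s)) ^ 2 := by gcongr
    _ = |bG L N m d p j k s| * (9 ^ (L * s) * (212 ^ (L * s)) ^ 2) * Q ^ 2 := by ring
    _ ≤ |bG L N m d p j k s| * 2 ^ (19 * (L * s)) * Q ^ 2 := by gcongr

lemma abs_exp_sub_le (a b W : ℝ) (ha : |a| ≤ W) (hb : |b| ≤ W) :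
    |Real.exp a - Real.exp b| ≤ Real.exp W * |a - b| := by
  have main : ∀ a b : ℝ, a ≤ W → b ≤ a → |Real.exp a - Real.exp b| ≤ Real.exp W * |a - b| := by
    intro a b ha hab
    have h1 : Real.exp b ≤ Real.exp a := Real.exp_le_exp.2 hab
    rw [abs_of_nonneg (by linarith), abs_of_nonneg (by linarith)]
    have h2 := Real.add_one_le_exp (b - a)
    have h3 : Real.exp b = Real.exp a * Real.exp (b - a) := by rw [← Real.exp_add]; ring_nf
    have h4 : Real.exp a ≤ Real.exp W := Real.exp_le_exp.2 ha
    have h5 := Real.exp_pos a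
    rw [h3]
    nlinarith
  rcases le_total b a with h | h
  · exact main a b (le_of_abs_le ha) h
  · rw [abs_sub_comm, abs_sub_comm a b]; exact main b a (le_of_abs_le hb) h

lemma bF_real {ι : Type} [Fintype ι] (p x y : ι → ℝ) (u v : ℝ) (j k s : ℕ) :
    bF p x y u v j k s = ((∑ i, p i * x i ^ j * y i ^ k * Real.exp ((x i * u + y i * v) * s) : ℝ) : ℂ) := by
  unfold bF
  push_cast
  rfl

lemma al3_pos (d : ℕ) (hd : 0 < d) : 0 < al3 d := by
  unfold al3
  have := pb_lb
  have h : (0 : ℝ) < d := by exact_mod_cast hd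
  positivity

/-- comparison of F and G -/
lemma bF_bG (L N m d : ℕ) (hd : 0 < d) (p : BI L → ℤ) (P A W Λ : ℝ)
    (hp : ∀ i, |(p i : ℝ)| ≤ P) (hA : 1 ≤ A) (hx : ∀ i, |(bg1 L N i : ℝ)| ≤ A)
    (hy : ∀ i, |(bg2 L m i : ℝ)| ≤ A) (hP : 0 ≤ P)
    (hΛ : Λ = N * Real.log pr - m * Real.log 10 - Real.log (al3 d))
    (hw : ∀ i, |(bg1 L N i : ℝ) * Real.log pr + (bg2 L m i : ℝ) * Real.log 10| ≤ W)
    (hw' : ∀ i : BI L, |((i.1 : ℕ) : ℝ) * Real.log pr + ((i.2.1 : ℕ) : ℝ) * Real.log 10 +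
      ((i.2.2 : ℕ) : ℝ) * Real.log (al3 d)| ≤ W)
    (j k s M : ℕ) (hM : j + k ≤ M) :
    ‖bF (fun i => (p i : ℝ)) (fun i => (bg1 L N i : ℝ)) (fun i => (bg2 L m i : ℝ))
      (Real.log pr) (Real.log 10) j k s - (bG L N m d p j k s : ℂ)‖ ≤
      (Fintype.card (BI L) * P * A ^ M) * (Real.exp (W * s) * (L * s * |Λ|)) := by
  rw [bF_real, ← Complex.ofReal_sub, Complex.norm_real, Real.norm_eq_abs]
  unfold bG
  rw [← Finset.sum_sub_distrib]
  have hb : ∀ i ∈ (Finset.univ : Finset (BI L)),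
      |(p i : ℝ) * (bg1 L N i : ℝ) ^ j * (bg2 L m i : ℝ) ^ k *
        Real.exp (((bg1 L N i : ℝ) * Real.log pr + (bg2 L m i : ℝ) * Real.log 10) * s) -
       (p i : ℝ) * (bg1 L N i : ℝ) ^ j * (bg2 L m i : ℝ) ^ k *
        (pr ^ (i.1 : ℕ) * 10 ^ (i.2.1 : ℕ) * al3 d ^ (i.2.2 : ℕ)) ^ s|
      ≤ P * A ^ M * (Real.exp (W * s) * (L * s * |Λ|)) := by
    intro i _
    have e0 : pr ^ (i.1 : ℕ) * 10 ^ (i.2.1 : ℕ) * al3 d ^ (i.2.2 : ℕ) =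
        Real.exp (((i.1 : ℕ) : ℝ) * Real.log pr + ((i.2.1 : ℕ) : ℝ) * Real.log 10 +
      ((i.2.2 : ℕ) : ℝ) * Real.log (al3 d)) := by
      rw [Real.exp_add, Real.exp_add, Real.exp_nat_mul, Real.exp_nat_mul, Real.exp_nat_mul,
        Real.exp_log pr_pos, Real.exp_log (by norm_num), Real.exp_log (al3_pos d hd)]
    rw [e0, ← Real.exp_nat_mul, ← mul_sub, abs_mul, abs_mul, abs_mul, abs_pow, abs_pow]
    have e1 : |(p i : ℝ)| * |(bg1 L N i : ℝ)| ^ j * |(bg2 L m i : ℝ)| ^ k ≤ P * A ^ M := by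
      calc |(p i : ℝ)| * |(bg1 L N i : ℝ)| ^ j * |(bg2 L m i : ℝ)| ^ k ≤ P * A ^ j * A ^ k := by
            gcongr
            · exact hp i
            · exact hx i
            · exact hy i
        _ = P * A ^ (j + k) := by ring
        _ ≤ P * A ^ M := by gcongr
    refine mul_le_mul e1 ?_ (abs_nonneg _) (by positivity)
    have hs : (0 : ℝ) ≤ s := Nat.cast_nonneg s
    refine (abs_exp_sub_le _ _ (W * s) ?_ ?_).trans ?_
    · rw [abs_mul, abs_of_nonneg hs]
      exact mul_le_mul_of_nonneg_right (hw i) hs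
    · rw [abs_mul, abs_of_nonneg hs, mul_comm]
      exact mul_le_mul_of_nonneg_right (hw' i) hs
    · refine mul_le_mul_of_nonneg_left ?_ (Real.exp_pos _).le
      have e2 : ((bg1 L N i : ℝ) * Real.log pr + (bg2 L m i : ℝ) * Real.log 10) * s -
        s * (((i.1 : ℕ) : ℝ) * Real.log pr + ((i.2.1 : ℕ) : ℝ) * Real.log 10 +
          ((i.2.2 : ℕ) : ℝ) * Real.log (al3 d)) = ((i.2.2 : ℕ) : ℝ) * s * Λ := by
        rw [hΛ]; unfold bg1 bg2; push_cast; ring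
      rw [e2, abs_mul, abs_mul, abs_of_nonneg hs, Nat.abs_cast]
      have : ((i.2.2 : ℕ) : ℝ) ≤ L := by exact_mod_cast i.2.2.2.le
      gcongr
  refine (Finset.abs_sum_le_sum_abs _ _).trans ((Finset.sum_le_sum hb).trans (le_of_eq ?_))
  rw [Finset.sum_const, nsmul_eq_mul, Finset.card_univ]
  ring


/-- Standing hypotheses of the extrapolation. -/
structure BD (L N m d : ℕ) (p : BI L → ℤ) (P A Λ : ℝ) (Z : ℕ) : Prop where
  hd : 0 < d
  hd9 : d ≤ 9
  hp : ∀ i, |(p i : ℝ)| ≤ P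
  hP : 0 ≤ P
  hA : 1 ≤ A
  hx : ∀ i, |(bg1 L N i : ℝ)| ≤ A
  hy : ∀ i, |(bg2 L m i : ℝ)| ≤ A
  hΛ : Λ = N * Real.log pr - m * Real.log 10 - Real.log (al3 d)
  hΛZ : |Λ| ≤ (1 / 2) ^ Z
  huv : |Real.log pr| + |Real.log 10| ≤ 3
  hw : ∀ i, |(bg1 L N i : ℝ) * Real.log pr + (bg2 L m i : ℝ) * Real.log 10| ≤ 7 * L * Real.log 2
  hw' : ∀ i : BI L, |((i.1 : ℕ) : ℝ) * Real.log pr + ((i.2.1 : ℕ) : ℝ) * Real.log 10 +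
      ((i.2.2 : ℕ) : ℝ) * Real.log (al3 d)| ≤ 7 * L * Real.log 2

lemma exp_log_two (k : ℕ) : Real.exp (k * Real.log 2) = 2 ^ k := by
  rw [Real.exp_nat_mul, Real.exp_log (by norm_num)]

lemma half_pow_le {a b : ℕ} (h : a ≤ b) : ((1 / 2 : ℝ)) ^ b * 2 ^ a ≤ 1 := by
  obtain ⟨c, rfl⟩ := Nat.exists_eq_add_of_le h
  rw [pow_add, mul_right_comm, ← mul_pow]
  norm_num
  exact pow_le_one₀ (by norm_num) (by norm_num)

/-- One extrapolation step. -/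
lemma baker_step (L N m d : ℕ) (p : BI L → ℤ) (P A Λ : ℝ) (Z : ℕ) (H : BD L N m d p P A Λ Z)
    (M M' D h h' q q0 T : ℕ) (hM : M' + D ≤ M) (hh : h ≤ h') (hpos : 0 < h')
    (hq : Fintype.card (BI L) * P * A ^ M' ≤ 2 ^ q) (hq0 : Fintype.card (BI L) * P * A ^ M ≤ 2 ^ q0)
    (hmid : 82 * (L * h') + 3 * q + 2 ≤ 2 * (D * h))
    (hT1 : h' * (D + 1) + 1 ≤ 2 ^ T) (hT2 : L * h' ≤ 2 ^ T)
    (hZ : 2 * D + q0 + 7 * (L * h') + T + T * (D * h) + 19 * (L * h') + 2 * q + 2 ≤ Z)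
    (hG : ∀ j k s, j + k < M → s < h → bG L N m d p j k s = 0) :
    ∀ j k s, j + k < M' → s < h' → bG L N m d p j k s = 0 := by
  intro j k s hjk hs
  by_contra hne
  set F := bF (fun i => (p i : ℝ)) (fun i => (bg1 L N i : ℝ)) (fun i => (bg2 L m i : ℝ))
      (Real.log pr) (Real.log 10) with hF
  have hl2 : (0 : ℝ) < Real.log 2 := Real.log_pos (by norm_num)
  have hWpos : (0 : ℝ) ≤ 7 * L * Real.log 2 := by positivity
  -- comparison error for all relevant points
  have cmp : ∀ j k s, j + k < M → s ≤ h' → ‖F j k s - (bG L N m d p j k s : ℂ)‖ ≤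
      2 ^ q0 * (2 ^ (7 * (L * h')) * (2 ^ T * |Λ|)) := by
    intro j k s hjk hs
    refine (bF_bG L N m d H.hd p P A _ Λ H.hp H.hA H.hx H.hy H.hP H.hΛ H.hw H.hw' j k s M hjk.le).trans ?_
    have hs' : (s : ℝ) ≤ h' := by exact_mod_cast hs
    have e1 : Real.exp (7 * L * Real.log 2 * s) ≤ 2 ^ (7 * (L * h')) := by
      rw [← exp_log_two]
      refine Real.exp_le_exp.2 ?_
      push_cast
      have : 7 * (L : ℝ) * Real.log 2 * s ≤ 7 * L * Real.log 2 * h' :=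
        mul_le_mul_of_nonneg_left hs' hWpos
      linarith
    have e2 : (L : ℝ) * s ≤ 2 ^ T := by
      have : (L : ℝ) * h' ≤ 2 ^ T := by exact_mod_cast hT2
      have h3 : (L : ℝ) * s ≤ L * h' := mul_le_mul_of_nonneg_left hs' (Nat.cast_nonneg _)
      linarith
    refine mul_le_mul hq0 ?_ (by positivity) (by positivity)
    refine mul_le_mul e1 ?_ (by positivity) (by positivity)
    exact mul_le_mul_of_nonneg_right e2 (abs_nonneg _)
  set ε : ℝ := 2 ^ q0 * (2 ^ (7 * (L * h')) * (2 ^ T * |Λ|)) with hε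
  have hε0 : 0 ≤ ε := by positivity
  have small : ∀ j k s : ℕ, j + k < M → s < h → ‖F j k s‖ ≤ ε := by
    intro j k s h1 h2
    have := cmp j k s h1 (by omega)
    rwa [hG j k s h1 h2, Complex.ofReal_zero, sub_zero] at this
  have ext := bF_extra _ _ _ _ _ H.huv P A _ H.hp H.hA H.hx H.hy H.hw H.hP hWpos M M' D h h' hM hh
    hpos ε hε0 small j k s hjk hs
  have c1 := cmp j k s (by omega) hs.le
  have tri : |bG L N m d p j k s| ≤ ‖F j k s‖ + ε := by
    have : ((bG L N m d p j k s : ℝ) : ℂ) = F j k s - (F j k s - (bG L N m d p j k s : ℂ)) := by ring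
    rw [← Real.norm_eq_abs, ← Complex.norm_real, this]
    exact (norm_sub_le _ _).trans (by linarith)
  have lio := bG_liouville L N m d H.hd9 p P A H.hp H.hA H.hx H.hy H.hP j k s M' hjk.le hne
  -- lower bound with powers of 2
  have lio2 : 1 ≤ |bG L N m d p j k s| * 2 ^ (19 * (L * h') + 2 * q) := by
    refine lio.trans ?_
    rw [pow_add, pow_mul 2 2 q, pow_right_comm, mul_assoc]
    have a1 : 19 * (L * s) ≤ 19 * (L * h') := by
      have := Nat.mul_le_mul_left L hs.le
      omega
    have hcard : 0 ≤ Fintype.card (BI L) * P * A ^ M' := by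
      have := H.hP
      have := H.hA
      positivity
    gcongr
    norm_num
  set E := 19 * (L * h') + 2 * q with hE
  -- term 1
  have t1 : 3 ^ D * ε * (h' * (D + 1) + 1 : ℝ) ^ (D * h) * 2 ^ (E + 2) ≤ 1 := by
    have a1 : (3 : ℝ) ^ D ≤ 2 ^ (2 * D) := by
      rw [pow_mul]; gcongr; norm_num
    have a2 : (h' * (D + 1) + 1 : ℝ) ^ (D * h) ≤ 2 ^ (T * (D * h)) := by
      rw [pow_mul (2 : ℝ) T]; gcongr; exact_mod_cast hT1
    calc 3 ^ D * ε * (h' * (D + 1) + 1 : ℝ) ^ (D * h) * 2 ^ (E + 2)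
        ≤ 2 ^ (2 * D) * (2 ^ q0 * (2 ^ (7 * (L * h')) * (2 ^ T * (1 / 2) ^ Z))) * 2 ^ (T * (D * h)) *
          2 ^ (E + 2) := by
          rw [hε]
          have := H.hΛZ
          gcongr
      _ = (1 / 2) ^ Z * 2 ^ (2 * D + q0 + 7 * (L * h') + T + T * (D * h) + (E + 2)) := by
          simp only [pow_add]; ring
      _ ≤ 1 := half_pow_le (by omega)
  have t3 : ε * 2 ^ (E + 2) ≤ 1 := by
    calc ε * 2 ^ (E + 2) ≤ (2 ^ q0 * (2 ^ (7 * (L * h')) * (2 ^ T * (1 / 2) ^ Z))) * 2 ^ (E + 2) := by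
          rw [hε]
          have := H.hΛZ
          gcongr
      _ = (1 / 2) ^ Z * 2 ^ (q0 + 7 * (L * h') + T + (E + 2)) := by
          simp only [pow_add]; ring
      _ ≤ 1 := half_pow_le (by omega)
  have t2 : (1 / 4) ^ (D * h) * ((Fintype.card (BI L) * P * A ^ M') *
      Real.exp (7 * L * Real.log 2 * (9 * h'))) * 2 ^ (E + 2) ≤ 1 := by
    have a1 : Real.exp (7 * L * Real.log 2 * (9 * h')) = 2 ^ (63 * (L * h')) := by
      rw [← exp_log_two]; congr 1; push_cast; ring
    have a2 : (1 / 4 : ℝ) ^ (D * h) = (1 / 2) ^ (2 * (D * h)) := by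
      rw [pow_mul (1 / 2 : ℝ) 2]; norm_num
    rw [a1, a2]
    calc _ ≤ (1 / 2 : ℝ) ^ (2 * (D * h)) * (2 ^ q * 2 ^ (63 * (L * h'))) * 2 ^ (E + 2) := by gcongr
      _ = (1 / 2) ^ (2 * (D * h)) * 2 ^ (q + 63 * (L * h') + (E + 2)) := by
          simp only [pow_add]; ring
      _ ≤ 1 := half_pow_le (by omega)
  have hX : (2 : ℝ) ^ (E + 2) = 2 ^ E * 4 := by rw [pow_add]; norm_num
  rw [hX] at t1 t2 t3
  have h2E : (0 : ℝ) < 2 ^ E := by positivity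
  have fin := mul_le_mul_of_nonneg_right (tri.trans (add_le_add ext le_rfl)) h2E.le
  nlinarith


/-! ### Siegel's lemma and the choice of parameters -/

section siegel
attribute [local instance] Matrix.seminormedAddCommGroup

lemma siegel_pow {α β : Type} [Fintype α] [Fintype β] (A : Matrix α β ℤ) (c X Y W : ℕ) (hc : 2 ≤ c)
    (hα : 0 < Fintype.card α) (hβ : Fintype.card β = c * Fintype.card α)
    (hA : ∀ i j, |A i j| ≤ 2 ^ X) (hY : Fintype.card β ≤ 2 ^ Y) (hW : X + Y ≤ (c - 1) * W) :
    ∃ t : β → ℤ, t ≠ 0 ∧ Matrix.mulVec A t = 0 ∧ ∀ i, |t i| ≤ 2 ^ W := by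
  obtain ⟨t, h1, h2, h3⟩ := Int.Matrix.exists_ne_zero_int_vec_norm_le A (by rw [hβ]; nlinarith) hα
  refine ⟨t, h1, h2, fun i => ?_⟩
  have hα' : (0 : ℝ) < Fintype.card α := by exact_mod_cast hα
  have hc' : (1 : ℝ) < c := by exact_mod_cast (by omega : 1 < c)
  have hex : ((Fintype.card α : ℝ) / (Fintype.card β - Fintype.card α)) = 1 / (c - 1) := by
    rw [hβ]; push_cast
    have : (c : ℝ) - 1 ≠ 0 := by linarith
    have h5 : (c : ℝ) * Fintype.card α - Fintype.card α = (c - 1) * Fintype.card α := by ring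
    rw [h5]
    field_simp
  have hnA : ‖A‖ ≤ 2 ^ X := by
    rw [Matrix.norm_le_iff (by positivity)]
    intro i j
    rw [Int.norm_eq_abs]
    exact_mod_cast hA i j
  have hb : (Fintype.card β : ℝ) * max 1 ‖A‖ ≤ 2 ^ ((c - 1) * W) := by
    calc (Fintype.card β : ℝ) * max 1 ‖A‖ ≤ 2 ^ Y * 2 ^ X := by
          refine mul_le_mul (by exact_mod_cast hY) (max_le ?_ hnA) (by positivity) (by positivity)
          exact one_le_pow₀ (by norm_num)
      _ = 2 ^ (X + Y) := by ring
      _ ≤ _ := pow_le_pow_right₀ (by norm_num) hW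
  have h4 : ‖t‖ ≤ 2 ^ W := by
    refine h3.trans ?_
    rw [hex]
    refine (Real.rpow_le_rpow (by positivity) hb (by
      apply div_nonneg <;> linarith)).trans (le_of_eq ?_)
    rw [mul_comm, pow_mul, ← Real.rpow_natCast _ (c - 1), ← Real.rpow_mul (by positivity),
      Nat.cast_sub (by omega)]
    have : (c : ℝ) - 1 ≠ 0 := by linarith
    push_cast
    rw [mul_one_div_cancel this, Real.rpow_one]
  have h5 := (norm_le_pi_norm t i).trans h4
  rw [Int.norm_eq_abs] at h5
  exact_mod_cast h5
end siegel

set_option exponentiation.threshold 2000 in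
lemma pow_e_bound (e : ℕ) (he : 600 ≤ e) : 2 ^ 312 * e ^ 22 ≤ 2 ^ e := by
  induction e, he using Nat.le_induction with
  | base => norm_num
  | succ e he ih =>
    have h1 : (e + 1) * 600 ≤ 601 * e := by omega
    have h2 := Nat.pow_le_pow_left h1 22
    rw [mul_pow, mul_pow] at h2
    have h3 : 601 ^ 22 ≤ 2 * 600 ^ 22 := by norm_num
    have h4 : (e + 1) ^ 22 * 600 ^ 22 ≤ (2 * e ^ 22) * 600 ^ 22 := by
      calc _ ≤ 601 ^ 22 * e ^ 22 := h2
        _ ≤ (2 * 600 ^ 22) * e ^ 22 := Nat.mul_le_mul_right _ h3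
        _ = _ := by ring
    have h5 := Nat.le_of_mul_le_mul_right h4 (by positivity)
    calc 2 ^ 312 * (e + 1) ^ 22 ≤ 2 ^ 312 * (2 * e ^ 22) := Nat.mul_le_mul_left _ h5
      _ = 2 * (2 ^ 312 * e ^ 22) := by ring
      _ ≤ 2 * 2 ^ e := Nat.mul_le_mul_left _ ih
      _ = 2 ^ (e + 1) := by ring

/-- monomials 2^a e^b below 2^A e^B -/
lemma mono_le (e : ℕ) (he : 1 ≤ e) {a b A B : ℕ} (h1 : a ≤ A) (h2 : b ≤ B) :
    2 ^ a * e ^ b ≤ 2 ^ A * e ^ B :=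
  Nat.mul_le_mul (Nat.pow_le_pow_right (by norm_num) h1) (Nat.pow_le_pow_right he h2)

lemma log_facts : 0 < Real.log pr ∧ Real.log pr ≤ 1 / 2 * Real.log 2 ∧ 0 < Real.log 10 ∧
    Real.log 10 ≤ 3.334 * Real.log 2 := by
  have h2 : 0 < Real.log 2 := Real.log_pos (by norm_num)
  refine ⟨Real.log_pos (by linarith [pr_lb]), ?_, Real.log_pos (by norm_num), ?_⟩
  · have : Real.log (pr ^ 2) ≤ Real.log 2 :=
      Real.log_le_log (by have := pr_pos; positivity) (by nlinarith [pr_ub, pr_lb])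
    rw [Real.log_pow] at this
    push_cast at this; linarith
  · have : Real.log ((10 : ℝ) ^ 3) ≤ Real.log ((2 : ℝ) ^ 10) :=
      Real.log_le_log (by norm_num) (by norm_num)
    rw [Real.log_pow, Real.log_pow] at this
    push_cast at this; linarith

lemma al3_log (d : ℕ) (hd : 0 < d) (hd9 : d ≤ 9) : |Real.log (al3 d)| ≤ 2.5 * Real.log 2 := by
  have h2 : 0 < Real.log 2 := Real.log_pos (by norm_num)
  have h1 := al3_pos d hd
  have hd' : (1 : ℝ) ≤ d := by exact_mod_cast hd
  have hd9' : (d : ℝ) ≤ 9 := by exact_mod_cast hd9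
  have hub : al3 d ≤ 4.27 := by
    unfold al3
    nlinarith [pb_ub, pb_lb]
  have hlb : 1 / 4 ≤ al3 d := by
    unfold al3
    nlinarith [pb_ub, pb_lb]
  rw [abs_le]
  constructor
  · have := Real.log_le_log (by norm_num) hlb
    have e4 : Real.log (1 / 4) = -(2 * Real.log 2) := by
      rw [show (1 / 4 : ℝ) = ((2 : ℝ) ^ 2)⁻¹ by norm_num, Real.log_inv, Real.log_pow]; push_cast; ring
    linarith
  · have : Real.log (al3 d ^ 2) ≤ Real.log ((2 : ℝ) ^ 5) :=
      Real.log_le_log (by positivity) (by nlinarith)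
    rw [Real.log_pow, Real.log_pow] at this
    push_cast at this; linarith

lemma bd_of (L N m d : ℕ) (p : BI L → ℤ) (P A Λ : ℝ) (Z : ℕ) (hd : 0 < d) (hd9 : d ≤ 9)
    (hp : ∀ i, |(p i : ℝ)| ≤ P) (hP : 0 ≤ P) (hA : 1 ≤ A) (hLA : (L : ℝ) * (N + 1) ≤ A)
    (hmN : m ≤ N) (hΛ : Λ = N * Real.log pr - m * Real.log 10 - Real.log (al3 d))
    (hΛZ : |Λ| ≤ (1 / 2) ^ Z) (hZ : 2 ≤ Z) : BD L N m d p P A Λ Z := by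
  have h2 : 0 < Real.log 2 := Real.log_pos (by norm_num)
  have hl1 := Real.log_two_lt_d9
  have hl2 := Real.log_two_gt_d9
  obtain ⟨u0, u1, v0, v1⟩ := log_facts
  have w := al3_log d hd hd9
  have hmN' : (m : ℝ) ≤ N := by exact_mod_cast hmN
  have hm0 : (0 : ℝ) ≤ m := Nat.cast_nonneg m
  have hΛ4 : |Λ| ≤ 1 / 4 := by
    refine hΛZ.trans ?_
    calc (1 / 2 : ℝ) ^ Z ≤ (1 / 2) ^ 2 := pow_le_pow_of_le_one (by norm_num) (by norm_num) hZ
      _ = 1 / 4 := by norm_num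
  have base : ∀ i : BI L, |((i.1 : ℕ) : ℝ) * Real.log pr + ((i.2.1 : ℕ) : ℝ) * Real.log 10 +
      ((i.2.2 : ℕ) : ℝ) * Real.log (al3 d)| ≤ 6.334 * L * Real.log 2 := by
    intro i
    have b1 : ((i.1 : ℕ) : ℝ) ≤ L := by exact_mod_cast i.1.2.le
    have b2 : ((i.2.1 : ℕ) : ℝ) ≤ L := by exact_mod_cast i.2.1.2.le
    have b3 : ((i.2.2 : ℕ) : ℝ) ≤ L := by exact_mod_cast i.2.2.2.le
    have c1 : |((i.1 : ℕ) : ℝ) * Real.log pr| ≤ L * (1 / 2 * Real.log 2) := by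
      rw [abs_mul, Nat.abs_cast, abs_of_pos u0]; gcongr
    have c2 : |((i.2.1 : ℕ) : ℝ) * Real.log 10| ≤ L * (3.334 * Real.log 2) := by
      rw [abs_mul, Nat.abs_cast, abs_of_pos v0]; gcongr
    have c3 : |((i.2.2 : ℕ) : ℝ) * Real.log (al3 d)| ≤ L * (2.5 * Real.log 2) := by
      rw [abs_mul, Nat.abs_cast]; gcongr
    refine (abs_add_three _ _ _).trans ?_
    linarith
  refine ⟨hd, hd9, hp, hP, hA, ?_, ?_, hΛ, hΛZ, ?_, ?_, ?_⟩
  · intro i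
    have b1 : ((i.1 : ℕ) : ℝ) ≤ L := by exact_mod_cast i.1.2.le
    have b3 : ((i.2.2 : ℕ) : ℝ) ≤ L := by exact_mod_cast i.2.2.2.le
    have : (bg1 L N i : ℝ) = ((i.1 : ℕ) : ℝ) + ((i.2.2 : ℕ) : ℝ) * N := by unfold bg1; push_cast; ring
    rw [this, abs_of_nonneg (by positivity)]
    have : ((i.2.2 : ℕ) : ℝ) * N ≤ L * N := by gcongr
    linarith
  · intro i
    have b1 : ((i.2.1 : ℕ) : ℝ) ≤ L := by exact_mod_cast i.2.1.2.le
    have b3 : ((i.2.2 : ℕ) : ℝ) ≤ L := by exact_mod_cast i.2.2.2.le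
    have : (bg2 L m i : ℝ) = ((i.2.1 : ℕ) : ℝ) - ((i.2.2 : ℕ) : ℝ) * m := by unfold bg2; push_cast; ring
    rw [this]
    have h3 : ((i.2.2 : ℕ) : ℝ) * m ≤ L * N := by gcongr
    have h4 : 0 ≤ ((i.2.2 : ℕ) : ℝ) * m := by positivity
    have h5 : (0 : ℝ) ≤ ((i.2.1 : ℕ) : ℝ) := by positivity
    rw [abs_le]
    constructor <;> nlinarith
  · rw [abs_of_pos u0, abs_of_pos v0]
    nlinarith
  · intro i
    have b3 : ((i.2.2 : ℕ) : ℝ) ≤ L := by exact_mod_cast i.2.2.2.le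
    have e : (bg1 L N i : ℝ) * Real.log pr + (bg2 L m i : ℝ) * Real.log 10 =
        (((i.1 : ℕ) : ℝ) * Real.log pr + ((i.2.1 : ℕ) : ℝ) * Real.log 10 +
        ((i.2.2 : ℕ) : ℝ) * Real.log (al3 d)) + ((i.2.2 : ℕ) : ℝ) * Λ := by
      rw [hΛ]; unfold bg1 bg2; push_cast; ring
    rw [e]
    refine (abs_add_le _ _).trans ?_
    have c4 : |((i.2.2 : ℕ) : ℝ) * Λ| ≤ L * (1 / 4) := by
      rw [abs_mul, Nat.abs_cast]; gcongr
    have c5 := base i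
    have hL : (0 : ℝ) ≤ L := Nat.cast_nonneg L
    nlinarith
  · intro i
    refine (base i).trans ?_
    have hL : (0 : ℝ) ≤ L := Nat.cast_nonneg L
    nlinarith [mul_nonneg hL h2.le]

/-- final contradiction: vanishing at card many points forces p = 0 -/
lemma van_zero (L N m d : ℕ) (hd : 0 < d) (hd9 : d ≤ 9) (p : BI L → ℤ)
    (h : ∀ s < Fintype.card (BI L), bG L N m d p 0 0 s = 0) : p = 0 := by
  let eq := Fintype.equivFin (BI L)
  let f : Fin (Fintype.card (BI L)) → ℝ := fun t =>
    pr ^ ((eq.symm t).1 : ℕ) * 10 ^ ((eq.symm t).2.1 : ℕ) * al3 d ^ ((eq.symm t).2.2 : ℕ)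
  let v : Fin (Fintype.card (BI L)) → ℝ := fun t => (p (eq.symm t) : ℝ)
  have hf : Function.Injective f := by
    intro t t' htt
    obtain ⟨a, b, c⟩ := mul_indep d hd hd9 _ _ _ _ _ _ htt
    apply eq.symm.injective
    exact Prod.ext (Fin.ext a) (Prod.ext (Fin.ext b) (Fin.ext c))
  have hv : v = 0 := by
    refine Matrix.eq_zero_of_forall_pow_sum_mul_pow_eq_zero hf fun i => ?_
    have h1 := h i i.2
    unfold bG at h1
    rw [← h1, ← Equiv.sum_comp eq.symm]
    refine Finset.sum_congr rfl fun t _ => ?_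
    simp [v, f]
  funext i
  have := congrFun hv (eq i)
  simpa [v] using this


/-- vanishing predicate -/
def Van (L N m d : ℕ) (p : BI L → ℤ) (M h : ℕ) : Prop :=
  ∀ j k s, j + k < M → s < h → bG L N m d p j k s = 0

set_option exponentiation.threshold 2000 in
/-- extrapolation with the size parameters plugged in -/
lemma baker_step' (e N m d : ℕ) (he : 600 ≤ e) (p : BI (2 ^ 69 * e ^ 5) → ℤ) (Λ : ℝ)
    (H : BD (2 ^ 69 * e ^ 5) N m d p (2 ^ (3 * (2 ^ 97 * e ^ 7))) (2 ^ (2 * e)) Λ (2 ^ 306 * e ^ 22))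
    (M M' D h h' : ℕ) (hM : M' + D ≤ M) (hM0 : M ≤ 2 ^ 101 * e ^ 7) (hD : D + 1 ≤ 2 ^ 101 * e ^ 7)
    (hh : h ≤ h') (hpos : 0 < h')
    (hh1 : h ≤ 2 ^ 199 * e ^ 14) (hh2 : h' ≤ 2 ^ 207 * e ^ 15)
    (hmid : 82 * (2 ^ 69 * e ^ 5 * h') + 3 * (4 * (2 ^ 97 * e ^ 7) + 2 * (e * M')) + 2 ≤ 2 * (D * h))
    (hV : Van (2 ^ 69 * e ^ 5) N m d p M h) : Van (2 ^ 69 * e ^ 5) N m d p M' h' := by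
  have hE := pow_e_bound e he
  have he1 : 1 ≤ e := by omega
  have hcard : Fintype.card (BI (2 ^ 69 * e ^ 5)) = 2 ^ 207 * e ^ 15 := by
    simp only [Fintype.card_prod, Fintype.card_fin]; ring
  have hq : ∀ M : ℕ, (Fintype.card (BI (2 ^ 69 * e ^ 5)) : ℝ) * 2 ^ (3 * (2 ^ 97 * e ^ 7)) *
      (2 ^ (2 * e)) ^ M ≤ 2 ^ (4 * (2 ^ 97 * e ^ 7) + 2 * (e * M)) := by
    intro M
    have h1 : (Fintype.card (BI (2 ^ 69 * e ^ 5)) : ℝ) ≤ 2 ^ (2 ^ 97 * e ^ 7) := by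
      rw [hcard]
      have : 2 ^ 207 * e ^ 15 ≤ 2 ^ (2 ^ 97 * e ^ 7) := by
        calc 2 ^ 207 * e ^ 15 ≤ 2 ^ 312 * e ^ 22 := mono_le e he1 (by norm_num) (by norm_num)
          _ ≤ 2 ^ e := hE
          _ ≤ 2 ^ (2 ^ 97 * e ^ 7) := by
            refine Nat.pow_le_pow_right (by norm_num) ?_
            calc e = 2 ^ 0 * e ^ 1 := by ring
              _ ≤ _ := mono_le e he1 (by norm_num) (by norm_num)
      exact_mod_cast this
    calc _ ≤ (2 : ℝ) ^ (2 ^ 97 * e ^ 7) * 2 ^ (3 * (2 ^ 97 * e ^ 7)) * (2 ^ (2 * e)) ^ M := by gcongr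
      _ = _ := by
        rw [← pow_mul, ← pow_add, ← pow_add]
        congr 1
        ring
  have hLh' : 2 ^ 69 * e ^ 5 * h' ≤ 2 ^ 276 * e ^ 20 := by
    calc 2 ^ 69 * e ^ 5 * h' ≤ 2 ^ 69 * e ^ 5 * (2 ^ 207 * e ^ 15) := Nat.mul_le_mul_left _ hh2
      _ = _ := by ring
  have hDh : D * h ≤ 2 ^ 300 * e ^ 21 := by
    calc D * h ≤ (2 ^ 101 * e ^ 7) * (2 ^ 199 * e ^ 14) := Nat.mul_le_mul (by omega) hh1
      _ = _ := by ring
  have heM : ∀ M, M ≤ 2 ^ 101 * e ^ 7 → e * M ≤ 2 ^ 101 * e ^ 8 := by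
    intro M hM
    calc e * M ≤ e * (2 ^ 101 * e ^ 7) := Nat.mul_le_mul_left _ hM
      _ = _ := by ring
  refine baker_step _ N m d p _ _ Λ _ H M M' D h h' (4 * (2 ^ 97 * e ^ 7) + 2 * (e * M'))
    (4 * (2 ^ 97 * e ^ 7) + 2 * (e * M)) e hM hh hpos (hq M') (hq M) ?_ ?_ ?_ ?_ hV
  · exact hmid
  · refine le_trans ?_ hE
    have h1 : h' * (D + 1) ≤ 2 ^ 308 * e ^ 22 := by
      calc h' * (D + 1) ≤ (2 ^ 207 * e ^ 15) * (2 ^ 101 * e ^ 7) := Nat.mul_le_mul hh2 hD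
        _ = _ := by ring
    have h2 : 1 ≤ e ^ 22 := Nat.one_le_pow _ _ he1
    have h3 : 2 ^ 308 * e ^ 22 + 1 ≤ 2 ^ 312 * e ^ 22 := by
      have : 2 ^ 312 * e ^ 22 = 16 * (2 ^ 308 * e ^ 22) := by ring
      have h4 : 0 < 2 ^ 308 * e ^ 22 := by positivity
      omega
    omega
  · exact (hLh'.trans (mono_le e he1 (by norm_num) (by norm_num))).trans hE
  · have m1 := heM M hM0
    have m2 := heM M' (by omega)
    have a1 : e * (D * h) ≤ 2 ^ 300 * e ^ 22 := by
      calc e * (D * h) ≤ e * (2 ^ 300 * e ^ 21) := Nat.mul_le_mul_left _ hDh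
        _ = _ := by ring
    have a2 : 2 ^ 276 * e ^ 20 ≤ 2 ^ 300 * e ^ 22 := mono_le e he1 (by norm_num) (by norm_num)
    have a3 : 2 ^ 101 * e ^ 8 ≤ 2 ^ 300 * e ^ 22 := mono_le e he1 (by norm_num) (by norm_num)
    have a4 : 2 ^ 97 * e ^ 7 ≤ 2 ^ 300 * e ^ 22 := mono_le e he1 (by norm_num) (by norm_num)
    have a5 : 2 ^ 101 * e ^ 7 ≤ 2 ^ 300 * e ^ 22 := mono_le e he1 (by norm_num) (by norm_num)
    have a6 : e ≤ 2 ^ 300 * e ^ 22 := by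
      calc e = 2 ^ 0 * e ^ 1 := by ring
        _ ≤ _ := mono_le e he1 (by norm_num) (by norm_num)
    have a7 : 2 ^ 306 * e ^ 22 = 64 * (2 ^ 300 * e ^ 22) := by ring
    rw [a7]
    generalize 2 ^ 300 * e ^ 22 = B at *
    generalize 2 ^ 69 * e ^ 5 * h' = b1 at *
    generalize e * (D * h) = b2 at *
    generalize 2 ^ 97 * e ^ 7 = b3 at *
    generalize e * M = b4 at *
    generalize e * M' = b5 at *
    generalize 2 ^ 101 * e ^ 7 = b6 at *
    omega

set_option exponentiation.threshold 2000 in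
lemma baker_mid (e N m d : ℕ) (he : 600 ≤ e) (p : BI (2 ^ 69 * e ^ 5) → ℤ) (Λ : ℝ)
    (H : BD (2 ^ 69 * e ^ 5) N m d p (2 ^ (3 * (2 ^ 97 * e ^ 7))) (2 ^ (2 * e)) Λ (2 ^ 306 * e ^ 22))
    (t a b : ℕ) (ht : 8 ≤ t) (ht' : t ≤ 20) (ha : 25 ≤ a) (ha' : a ≤ 199) (hb : 2 ≤ b) (hb' : b ≤ 14)
    (hat : a + t ≤ 207)
    (hV : Van (2 ^ 69 * e ^ 5) N m d p (2 ^ (t + 76) * e ^ 6) (2 ^ a * e ^ b)) :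
    Van (2 ^ 69 * e ^ 5) N m d p (2 ^ (t + 75) * e ^ 6) (2 ^ (a + t) * e ^ (b + 1)) := by
  have he1 : 1 ≤ e := by omega
  refine baker_step' e N m d he p Λ H _ _ (2 ^ (t + 75) * e ^ 6) _ _ ?_ ?_ ?_ ?_ ?_ ?_ ?_ ?_ hV
  · apply le_of_eq; rw [show t + 76 = t + 75 + 1 by ring, pow_succ]; ring
  · exact mono_le e he1 (by omega) (by norm_num)
  · have h1 : 2 ^ (t + 75) * e ^ 6 ≤ 2 ^ 100 * e ^ 7 := mono_le e he1 (by omega) (by norm_num)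
    have h2 : 0 < 2 ^ 100 * e ^ 7 := by positivity
    have h3 : 2 ^ 101 * e ^ 7 = 2 * (2 ^ 100 * e ^ 7) := by ring
    omega
  · exact mono_le e he1 (by omega) (by omega)
  · positivity
  · exact mono_le e he1 (by omega) (by omega)
  · exact mono_le e he1 (by omega) (by omega)
  · have e1 : 2 ^ 69 * e ^ 5 * (2 ^ (a + t) * e ^ (b + 1)) = 2 ^ (69 + a + t) * e ^ (6 + b) := by
      rw [show 2 ^ (69 + a + t) * e ^ (6 + b) = 2 ^ (69 + (a + t)) * e ^ (5 + (b + 1)) by ring_nf,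
        pow_add, pow_add]; ring
    have e2 : 2 ^ (t + 75) * e ^ 6 * (2 ^ a * e ^ b) = 64 * (2 ^ (69 + a + t) * e ^ (6 + b)) := by
      rw [show 69 + a + t = t + 69 + a by ring, show t + 75 = t + 69 + 6 by ring]
      simp only [pow_add]; ring
    have e3 : e * (2 ^ (t + 75) * e ^ 6) ≤ 2 ^ 95 * e ^ 7 := by
      calc e * (2 ^ (t + 75) * e ^ 6) = 2 ^ (t + 75) * e ^ 7 := by ring
        _ ≤ _ := mono_le e he1 (by omega) (by norm_num)
    have e4 : 2 ^ 97 * e ^ 7 = 4 * (2 ^ 95 * e ^ 7) := by ring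
    have e5 : 2 ^ 102 * e ^ 8 ≤ 2 ^ (69 + a + t) * e ^ (6 + b) := mono_le e he1 (by omega) (by omega)
    have e6 : 2 ^ 102 * e ^ 7 ≤ 2 ^ 102 * e ^ 8 := mono_le e he1 (by omega) (by omega)
    have e7 : 2 ^ 102 * e ^ 7 = 128 * (2 ^ 95 * e ^ 7) := by ring
    have e8 : 0 < 2 ^ 95 * e ^ 7 := by positivity
    rw [e1, e2, e4]
    generalize 2 ^ (69 + a + t) * e ^ (6 + b) = x at *
    generalize e * (2 ^ (t + 75) * e ^ 6) = y at *
    generalize 2 ^ 95 * e ^ 7 = z at *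
    generalize 2 ^ 102 * e ^ 8 = w at *
    generalize 2 ^ 102 * e ^ 7 = w' at *
    omega

set_option exponentiation.threshold 2000 in
lemma baker_start (e N m d : ℕ) (he : 600 ≤ e) (p : BI (2 ^ 69 * e ^ 5) → ℤ) (Λ : ℝ)
    (H : BD (2 ^ 69 * e ^ 5) N m d p (2 ^ (3 * (2 ^ 97 * e ^ 7))) (2 ^ (2 * e)) Λ (2 ^ 306 * e ^ 22))
    (hV : Van (2 ^ 69 * e ^ 5) N m d p (2 ^ 101 * e ^ 7) 1) :
    Van (2 ^ 69 * e ^ 5) N m d p (2 ^ 96 * e ^ 6) (2 ^ 25 * e ^ 2) := by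
  have he1 : 1 ≤ e := by omega
  have r1 : 2 ^ 96 * e ^ 6 ≤ 2 ^ 96 * e ^ 7 := mono_le e he1 (by omega) (by norm_num)
  have r2 : 2 ^ 101 * e ^ 7 = 128 * (2 ^ 94 * e ^ 7) := by ring
  have r3 : 2 ^ 96 * e ^ 7 = e * (2 ^ 96 * e ^ 6) := by ring
  have r4 : 2 ^ 96 * e ^ 7 = 4 * (2 ^ 94 * e ^ 7) := by ring
  have r5 : 600 * (2 ^ 96 * e ^ 6) ≤ e * (2 ^ 96 * e ^ 6) := Nat.mul_le_mul_right _ he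
  have r6 : 0 < 2 ^ 96 * e ^ 6 := by positivity
  have r7 : 2 ^ 97 * e ^ 7 = 8 * (2 ^ 94 * e ^ 7) := by ring
  have r8 : 2 ^ 69 * e ^ 5 * (2 ^ 25 * e ^ 2) = 2 ^ 94 * e ^ 7 := by ring
  refine baker_step' e N m d he p Λ H _ _ (2 ^ 101 * e ^ 7 - 2 ^ 96 * e ^ 6) 1 _ ?_ le_rfl ?_ ?_ ?_ ?_ ?_ ?_ hV
  · omega
  · omega
  · exact Nat.one_le_iff_ne_zero.2 (by positivity)
  · positivity
  · exact Nat.one_le_iff_ne_zero.2 (by positivity)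
  · exact mono_le e he1 (by omega) (by omega)
  · rw [r8, r7, mul_one]
    generalize 2 ^ 94 * e ^ 7 = x at *
    generalize e * (2 ^ 96 * e ^ 6) = y at *
    generalize 2 ^ 96 * e ^ 7 = z at *
    generalize 2 ^ 101 * e ^ 7 = w at *
    generalize 2 ^ 96 * e ^ 6 = w' at *
    omega

set_option exponentiation.threshold 2000 in
/-- The lower bound for the linear form in logarithms. -/
theorem baker_bound (e N m d : ℕ) (he : 600 ≤ e) (hN : N < 2 ^ (e + 1)) (hmN : m ≤ N)
    (hd : 0 < d) (hd9 : d ≤ 9) :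
    (1 / 2 : ℝ) ^ (2 ^ 306 * e ^ 22) <
      |N * Real.log pr - m * Real.log 10 - Real.log (al3 d)| := by
  by_contra hcon
  push Not at hcon
  have he1 : 1 ≤ e := by omega
  have hE := pow_e_bound e he
  have hLA : (2 ^ 69 * e ^ 5) * (N + 1) ≤ 2 ^ (2 * e) := by
    have h1 : 2 * (2 ^ 69 * e ^ 5) ≤ 2 ^ e := by
      calc 2 * (2 ^ 69 * e ^ 5) = 2 ^ 70 * e ^ 5 := by ring
        _ ≤ 2 ^ 312 * e ^ 22 := mono_le e he1 (by norm_num) (by norm_num)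
        _ ≤ 2 ^ e := hE
    calc (2 ^ 69 * e ^ 5) * (N + 1) ≤ (2 ^ 69 * e ^ 5) * 2 ^ (e + 1) := Nat.mul_le_mul_left _ hN
      _ = 2 * (2 ^ 69 * e ^ 5) * 2 ^ e := by ring
      _ ≤ 2 ^ e * 2 ^ e := Nat.mul_le_mul_right _ h1
      _ = 2 ^ (2 * e) := by ring
  have hLA' : ((2 ^ 69 * e ^ 5 : ℕ) : ℝ) * (N + 1) ≤ 2 ^ (2 * e) := by exact_mod_cast hLA
  have bd0 : ∀ p : BI (2 ^ 69 * e ^ 5) → ℤ, (∀ i, |p i| ≤ 2 ^ (3 * (2 ^ 97 * e ^ 7))) →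
      BD (2 ^ 69 * e ^ 5) N m d p (2 ^ (3 * (2 ^ 97 * e ^ 7))) (2 ^ (2 * e))
        (N * Real.log pr - m * Real.log 10 - Real.log (al3 d)) (2 ^ 306 * e ^ 22) := by
    intro p hp
    refine bd_of _ N m d p _ _ _ _ hd hd9 (fun i => by exact_mod_cast hp i) (by positivity)
      (one_le_pow₀ (by norm_num)) hLA' hmN rfl hcon ?_
    calc 2 = 2 ^ 1 * e ^ 0 := by ring
      _ ≤ _ := mono_le e he1 (by norm_num) (by norm_num)
  have B0 := bd0 0 (by intro i; simp)
  have hcard : Fintype.card (BI (2 ^ 69 * e ^ 5)) = 2 ^ 207 * e ^ 15 := by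
    simp only [Fintype.card_prod, Fintype.card_fin]; ring
  have hcardα : Fintype.card (Fin (2 ^ 101 * e ^ 7) × Fin (2 ^ 101 * e ^ 7)) = 2 ^ 202 * e ^ 14 := by
    simp only [Fintype.card_prod, Fintype.card_fin]; ring
  obtain ⟨p, hp0, hpA, hpb⟩ := siegel_pow
    (fun (r : Fin (2 ^ 101 * e ^ 7) × Fin (2 ^ 101 * e ^ 7)) (i : BI (2 ^ 69 * e ^ 5)) =>
      bg1 _ N i ^ (r.1 : ℕ) * bg2 _ m i ^ (r.2 : ℕ)) (32 * e) (2 * e * (2 * (2 ^ 101 * e ^ 7))) e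
      (3 * (2 ^ 97 * e ^ 7)) (by omega) (by rw [hcardα]; positivity) (by rw [hcard, hcardα]; ring)
      (by
        intro r i
        have h1 : |bg1 (2 ^ 69 * e ^ 5) N i| ≤ 2 ^ (2 * e) := by exact_mod_cast B0.hx i
        have h2 : |bg2 (2 ^ 69 * e ^ 5) m i| ≤ 2 ^ (2 * e) := by exact_mod_cast B0.hy i
        have h3 : (1 : ℤ) ≤ 2 ^ (2 * e) := one_le_pow₀ (by norm_num)
        rw [abs_mul, abs_pow, abs_pow]
        calc _ ≤ ((2 : ℤ) ^ (2 * e)) ^ (r.1 : ℕ) * (2 ^ (2 * e)) ^ (r.2 : ℕ) := by gcongr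
          _ ≤ ((2 : ℤ) ^ (2 * e)) ^ (2 ^ 101 * e ^ 7) * (2 ^ (2 * e)) ^ (2 ^ 101 * e ^ 7) := by
            gcongr
            · exact r.1.2.le
            · exact r.2.2.le
          _ = _ := by
            rw [← pow_add, ← pow_mul]
            congr 1
            ring)
      (by
        rw [hcard]
        exact (mono_le e he1 (by norm_num) (by norm_num)).trans hE)
      (by
        have h1 : 2 * e * (2 * (2 ^ 101 * e ^ 7)) = 64 * (e * (2 ^ 97 * e ^ 7)) := by ring
        have h2 : (32 * e - 1) * (3 * (2 ^ 97 * e ^ 7)) = 96 * (e * (2 ^ 97 * e ^ 7)) - 3 * (2 ^ 97 * e ^ 7) := by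
          rw [Nat.sub_mul]; congr 1 <;> ring
        have h3 : 600 * (2 ^ 97 * e ^ 7) ≤ e * (2 ^ 97 * e ^ 7) := Nat.mul_le_mul_right _ he
        have h4 : e ≤ 2 ^ 97 * e ^ 7 := by
          calc e = 2 ^ 0 * e ^ 1 := by ring
            _ ≤ _ := mono_le e he1 (by norm_num) (by norm_num)
        rw [h1, h2]
        generalize e * (2 ^ 97 * e ^ 7) = x at *
        generalize 2 ^ 97 * e ^ 7 = y at *
        omega)
  have H := bd0 p hpb
  have V0 : Van (2 ^ 69 * e ^ 5) N m d p (2 ^ 101 * e ^ 7) 1 := by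
    intro j k s hjk hs
    obtain rfl : s = 0 := by omega
    have := congrFun hpA (⟨j, by omega⟩, ⟨k, by omega⟩)
    simp only [Matrix.mulVec, dotProduct, Pi.zero_apply] at this
    unfold bG
    simp only [pow_zero, mul_one]
    have h2 : ((∑ i, (bg1 (2 ^ 69 * e ^ 5) N i ^ j * bg2 (2 ^ 69 * e ^ 5) m i ^ k) * p i : ℤ) : ℝ) = 0 := by
      exact_mod_cast this
    simp only [Int.cast_sum, Int.cast_mul, Int.cast_pow] at h2
    rw [← h2]
    refine Finset.sum_congr rfl fun i _ => by ring
  have V1 := baker_start e N m d he p _ H V0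
  have st := baker_mid e N m d he p _ H
  have V2 := st 20 25 2 (by norm_num) (by norm_num) (by norm_num) (by norm_num) (by norm_num) (by norm_num) (by norm_num) V1
  have V3 := st 19 45 3 (by norm_num) (by norm_num) (by norm_num) (by norm_num) (by norm_num) (by norm_num) (by norm_num) V2
  have V4 := st 18 64 4 (by norm_num) (by norm_num) (by norm_num) (by norm_num) (by norm_num) (by norm_num) (by norm_num) V3
  have V5 := st 17 82 5 (by norm_num) (by norm_num) (by norm_num) (by norm_num) (by norm_num) (by norm_num) (by norm_num) V4
  have V6 := st 16 99 6 (by norm_num) (by norm_num) (by norm_num) (by norm_num) (by norm_num) (by norm_num) (by norm_num) V5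
  have V7 := st 15 115 7 (by norm_num) (by norm_num) (by norm_num) (by norm_num) (by norm_num) (by norm_num) (by norm_num) V6
  have V8 := st 14 130 8 (by norm_num) (by norm_num) (by norm_num) (by norm_num) (by norm_num) (by norm_num) (by norm_num) V7
  have V9 := st 13 144 9 (by norm_num) (by norm_num) (by norm_num) (by norm_num) (by norm_num) (by norm_num) (by norm_num) V8
  have V10 := st 12 157 10 (by norm_num) (by norm_num) (by norm_num) (by norm_num) (by norm_num) (by norm_num) (by norm_num) V9
  have V11 := st 11 169 11 (by norm_num) (by norm_num) (by norm_num) (by norm_num) (by norm_num) (by norm_num) (by norm_num) V10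
  have V12 := st 10 180 12 (by norm_num) (by norm_num) (by norm_num) (by norm_num) (by norm_num) (by norm_num) (by norm_num) V11
  have V13 := st 9 190 13 (by norm_num) (by norm_num) (by norm_num) (by norm_num) (by norm_num) (by norm_num) (by norm_num) V12
  have V14 := st 8 199 14 (by norm_num) (by norm_num) (by norm_num) (by norm_num) (by norm_num) (by norm_num) (by norm_num) V13
  apply hp0
  refine van_zero _ N m d hd hd9 p fun s hs => V14 0 0 s (by positivity) ?_
  rw [hcard] at hs
  exact hs


/-! ### Certified fixed point logarithms -/

def atLo (S x2 : ℕ) : ℕ → ℕ → ℕ → ℕ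
  | 0, _, _ => 0
  | n + 1, i, y => y / i + atLo S x2 n (i + 2) (y * x2 / S)

def atHi (S x2 : ℕ) : ℕ → ℕ → ℕ → ℕ
  | 0, _, y => 2 * y
  | n + 1, i, y => y / i + 1 + atHi S x2 n (i + 2) (y * x2 / S + 1)

def logLo (S A n : ℕ) : ℕ :=
  2 * atLo S ((S * (A - S) / (A + S)) * (S * (A - S) / (A + S)) / S) n 1 (S * (A - S) / (A + S))

def logHi (S A n : ℕ) : ℕ :=
  2 * atHi S ((S * (A - S) / (A + S) + 1) * (S * (A - S) / (A + S) + 1) / S + 1) n 1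
    (S * (A - S) / (A + S) + 1)

lemma nat_div_le_real (a b : ℕ) : ((a / b : ℕ) : ℝ) ≤ (a : ℝ) / b := Nat.cast_div_le
lemma real_le_nat_div (a b : ℕ) (hb : 0 < b) : (a : ℝ) / b ≤ ((a / b + 1 : ℕ) : ℝ) := by
  have hb' : (0 : ℝ) < b := by exact_mod_cast hb
  rw [div_le_iff₀ hb']
  have := Nat.lt_div_mul_add (a := a) hb
  have h2 : a ≤ (a / b + 1) * b := by nlinarith
  exact_mod_cast h2

lemma atLo_le (S x2 : ℕ) (x : ℝ) (hS : 0 < S) (hx : 0 ≤ x) (hx2 : (x2 : ℝ) ≤ S * x ^ 2) (n : ℕ) :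
    ∀ i y : ℕ, 0 < i → (y : ℝ) ≤ S * x ^ i →
      (atLo S x2 n i y : ℝ) ≤ S * ∑ k ∈ Finset.range n, x ^ (i + 2 * k) / ((i : ℝ) + 2 * k) := by
  have hS' : (0 : ℝ) < S := by exact_mod_cast hS
  induction n with
  | zero => intro i y _ _; simp [atLo]
  | succ n ih =>
    intro i y hi hy
    have hi' : (0 : ℝ) < i := by exact_mod_cast hi
    have h1 : ((y * x2 / S : ℕ) : ℝ) ≤ S * x ^ (i + 2) := by
      refine (nat_div_le_real _ _).trans ?_
      rw [div_le_iff₀ hS']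
      push_cast
      calc (y : ℝ) * x2 ≤ (S * x ^ i) * (S * x ^ 2) := by gcongr
        _ = _ := by ring
    have h2 := ih (i + 2) _ (by omega) h1
    rw [Finset.sum_range_succ']
    simp only [atLo]
    push_cast at h2 ⊢
    have h3 : ((y / i : ℕ) : ℝ) ≤ S * (x ^ i / i) := by
      refine (nat_div_le_real _ _).trans ?_
      rw [← mul_div_assoc]
      gcongr
    have h4 : ∀ k : ℕ, x ^ (i + 2 * (k + 1)) / ((i : ℝ) + 2 * (k + 1)) =
        x ^ (i + 2 + 2 * k) / ((i : ℝ) + 2 + 2 * k) := by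
      intro k
      congr 1
      · congr 1; ring
      · ring
    simp only [h4]
    rw [mul_add]
    simp only [mul_zero, add_zero]
    linarith

lemma atHi_ge (S x2 : ℕ) (x : ℝ) (hS : 0 < S) (hx : 0 ≤ x) (hx1 : x ^ 2 ≤ 1 / 2)
    (hx2 : S * x ^ 2 ≤ (x2 : ℝ)) (n : ℕ) :
    ∀ i y : ℕ, 0 < i → S * x ^ i ≤ (y : ℝ) →
      S * ((∑ k ∈ Finset.range n, x ^ (i + 2 * k) / ((i : ℝ) + 2 * k)) + x ^ (i + 2 * n) / (1 - x ^ 2))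
        ≤ (atHi S x2 n i y : ℝ) := by
  have hS' : (0 : ℝ) < S := by exact_mod_cast hS
  induction n with
  | zero =>
    intro i y _ hy
    simp only [atHi, Finset.range_zero, Finset.sum_empty, zero_add, mul_zero, add_zero]
    push_cast
    have h1 : 0 < 1 - x ^ 2 := by linarith
    rw [← mul_div_assoc, div_le_iff₀ h1]
    have h2 : (0 : ℝ) ≤ y := Nat.cast_nonneg y
    nlinarith
  | succ n ih =>
    intro i y hi hy
    have hi' : (0 : ℝ) < i := by exact_mod_cast hi
    have h1 : S * x ^ (i + 2) ≤ ((y * x2 / S + 1 : ℕ) : ℝ) := by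
      refine le_trans ?_ (real_le_nat_div _ _ hS)
      rw [le_div_iff₀ hS']
      push_cast
      calc (S * x ^ (i + 2)) * S = (S * x ^ i) * (S * x ^ 2) := by ring
        _ ≤ (y : ℝ) * x2 := by gcongr
    have h2 := ih (i + 2) _ (by omega) h1
    rw [Finset.sum_range_succ']
    simp only [atHi]
    push_cast at h2 ⊢
    have h3 : S * (x ^ i / i) ≤ ((y / i : ℕ) : ℝ) + 1 := by
      have := real_le_nat_div y i hi
      push_cast at this
      refine le_trans ?_ this
      rw [← mul_div_assoc]
      gcongr
    have h4 : ∀ k : ℕ, x ^ (i + 2 * (k + 1)) / ((i : ℝ) + 2 * (k + 1)) =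
        x ^ (i + 2 + 2 * k) / ((i : ℝ) + 2 + 2 * k) := by
      intro k
      congr 1
      · congr 1; ring
      · ring
    have h5 : x ^ (i + 2 * (n + 1)) = x ^ (i + 2 + 2 * n) := by congr 1; ring
    simp only [h4, h5]
    simp only [mul_zero, add_zero]
    rw [mul_add] at h2 ⊢
    rw [mul_add]
    linarith

lemma log_at (r : ℝ) (hr : 1 ≤ r) : (1 + (r - 1) / (r + 1)) / (1 - (r - 1) / (r + 1)) = r := by
  have : r + 1 ≠ 0 := by linarith
  have h2 : 1 - (r - 1) / (r + 1) = 2 / (r + 1) := by field_simp; ring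
  have h3 : 1 + (r - 1) / (r + 1) = 2 * r / (r + 1) := by field_simp; ring
  rw [h2, h3]
  field_simp

lemma logLo_le (S A n : ℕ) (r : ℝ) (hS : 0 < S) (hA : S ≤ A) (hr : (A : ℝ) ≤ S * r) :
    (logLo S A n : ℝ) ≤ S * Real.log r := by
  have hS' : (0 : ℝ) < S := by exact_mod_cast hS
  have hA' : (S : ℝ) ≤ A := by exact_mod_cast hA
  have hr1 : 1 ≤ r := by nlinarith
  set x : ℝ := (r - 1) / (r + 1) with hx
  have hx0 : 0 ≤ x := div_nonneg (by linarith) (by linarith)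
  have hx1 : x < 1 := by rw [hx, div_lt_one (by linarith)]; linarith
  have h1 : ((S * (A - S) / (A + S) : ℕ) : ℝ) ≤ S * x := by
    refine (nat_div_le_real _ _).trans ?_
    push_cast [Nat.cast_sub hA]
    rw [hx, mul_div_assoc]
    refine mul_le_mul_of_nonneg_left ?_ hS'.le
    rw [div_le_div_iff₀ (by linarith) (by linarith)]
    nlinarith
  have h2 : (((S * (A - S) / (A + S)) * (S * (A - S) / (A + S)) / S : ℕ) : ℝ) ≤ S * x ^ 2 := by
    refine (nat_div_le_real _ _).trans ?_
    rw [div_le_iff₀ hS']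
    push_cast
    calc ((S * (A - S) / (A + S) : ℕ) : ℝ) * ((S * (A - S) / (A + S) : ℕ) : ℝ)
        ≤ (S * x) * (S * x) := by gcongr
      _ = _ := by ring
  have h3 := atLo_le S _ x hS hx0 h2 n 1 _ one_pos (by rw [pow_one]; exact h1)
  have h4 := Real.sum_range_le_log_div hx0 hx1 n
  rw [hx, log_at r hr1, ← hx] at h4
  unfold logLo
  push_cast at h3 ⊢
  have h5 : ∑ k ∈ Finset.range n, x ^ (1 + 2 * k) / (1 + 2 * (k : ℝ)) =
      ∑ i ∈ Finset.range n, x ^ (2 * i + 1) / (2 * (i : ℝ) + 1) :=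
    Finset.sum_congr rfl fun k _ => by rw [add_comm 1 (2 * k), add_comm (1 : ℝ)]
  rw [h5] at h3
  have h6 := mul_le_mul_of_nonneg_left h4 hS'.le
  linarith

lemma logHi_ge (S A n : ℕ) (r : ℝ) (hS : 0 < S) (hA : S ≤ A) (hr1 : 1 ≤ r) (hr2 : r ≤ 4)
    (hr : S * r ≤ (A : ℝ)) : S * Real.log r ≤ (logHi S A n : ℝ) := by
  have hS' : (0 : ℝ) < S := by exact_mod_cast hS
  have hA' : (S : ℝ) ≤ A := by exact_mod_cast hA
  set x : ℝ := (r - 1) / (r + 1) with hx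
  have hx0 : 0 ≤ x := div_nonneg (by linarith) (by linarith)
  have hx35 : x ≤ 3 / 5 := by rw [hx, div_le_div_iff₀ (by linarith) (by norm_num)]; linarith
  have hx1 : x < 1 := by linarith
  have h1 : S * x ≤ ((S * (A - S) / (A + S) + 1 : ℕ) : ℝ) := by
    refine le_trans ?_ (real_le_nat_div _ _ (by omega))
    push_cast [Nat.cast_sub hA]
    rw [hx, mul_div_assoc]
    refine mul_le_mul_of_nonneg_left ?_ hS'.le
    rw [div_le_div_iff₀ (by linarith) (by linarith)]
    nlinarith
  have h2 : S * x ^ 2 ≤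
      (((S * (A - S) / (A + S) + 1) * (S * (A - S) / (A + S) + 1) / S + 1 : ℕ) : ℝ) := by
    refine le_trans ?_ (real_le_nat_div _ _ hS)
    rw [le_div_iff₀ hS']
    rw [Nat.cast_mul]
    calc S * x ^ 2 * S = (S * x) * (S * x) := by ring
      _ ≤ _ := by gcongr
  have h3 := atHi_ge S _ x hS hx0 (by nlinarith) h2 n 1 _ one_pos (by rw [pow_one]; exact h1)
  have h4 := Real.log_div_le_sum_range_add hx0 hx1 n
  rw [hx, log_at r hr1, ← hx] at h4
  unfold logHi
  rw [Nat.cast_mul]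
  have h5 : ∑ k ∈ Finset.range n, x ^ (1 + 2 * k) / (((1 : ℕ) : ℝ) + 2 * (k : ℝ)) =
      ∑ i ∈ Finset.range n, x ^ (2 * i + 1) / (2 * (i : ℝ) + 1) :=
    Finset.sum_congr rfl fun k _ => by rw [add_comm 1 (2 * k), Nat.cast_one, add_comm (1 : ℝ)]
  rw [h5, add_comm 1 (2 * n)] at h3
  have h6 := mul_le_mul_of_nonneg_left h4 hS'.le
  push_cast at h3 ⊢
  linarith


/-! ### Numerical logarithms and the Baker--Davenport reduction -/

def sS : ℕ := 2 ^ 1280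

def sR : ℕ := 27575149352115298191110784160350583696808374589366102357045939834322733651502684666495265630630577153825896744949591739715223347043362425084681503993631092319107949351299828966890925653260761351464859899385358224331115121778678411071783611077736733214244651001700079966125248193326923420332035598358783169818855230534185828707065848871496649481551996761732834287244140228086352493831371

def qq : ℕ := 1071512254419487948902880720278236541878238371871468132400898234000509342813024934092475707280169307332869581911711572221849826014023227752721020719048094175440930483259529267548477228

def qp : ℕ := 130856744769769239179195985073007991182723322593561150559208675369510923236486408571654173076740215729366261961051595181774090485232804907247625824201796184517484628213826921856267125

def n_l2 : ℕ := 14428457712381424166331996057070641000462115023090062525008780274248694817084870220510849640334226476851370989721112648379284412547213092243597381583441427254134431243774553357819472849271950733241112380621688460498491739561516792740385186607664476128997354208851529671304231257882266978437307273139318246756007888928318456554033734083294325108951087540245438198210534371589401725674390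

def n_l32 : ℕ := 8440106704984090302025717675878951720661057416373704858552297768855164739838372021401262908144785047489272740222061419262929942717060874709292246693648917378652587740340769606387581442221117480241759630459911627066417553457595463113033177037884194511743397425192224299663675020453640085455643754603615399658000450699432015488912270443135095623112325456016574905271737613333896342177076

def n_l54 : ℕ := 4644925903509822194679197053958737851003463606482137367814618286588185935346652291755261296189158463098277147889085923692300510453997718834847510966384980839784660604565830142199546837976864863845087491670335550477177090949055277630522866106175022160749713927982848436324973202043099167110788028127891533477694088618791095019764953961661858200918591702630731109074278357822691131640897

def n_l87 : ℕ := 2779571360590282595988181967970730487463657447394266419496776516557640977779693432253850949005780772455223118126652928675568231552844606264540710005229161381493847548272963281696675389400206961947502248349573384398988829098913163875210732132224810908081636108020827695662908474032097809407055327724142535420387929556236322086387461200645837553869715633270294948771546680375145355624880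

def n_lr : ℕ := 5853412205443758189528807981052514523405039779350049889988165675525421885953905975167952514241151587953933242988424505453979364589085190897765324496441911145140204121227626766299827889225916368962535768694099949708174819472519118860614711564175271388393855413263072192977259381819177027457860222104923419912838931042679297027835493593554461424587801706941364787722468333068897419099857

def n_lb : ℕ := 1333501045834252743166904427578697644774832315237157478307474095629849007654756911040198738858607269257994198874115149540962045998247333308397770459432693395668579942735520867688791963606873164429314298529487924679019060837269552854939767531184247956424158276384930142494073187307497483434407030789669032317891729297660340112715137794140302403307056855045688638753296557097178769509828

set_option maxRecDepth 100000 in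
lemma n_l2_lo : n_l2 ≤ logLo sS (2 * sS) 430 := by decide +kernel

set_option maxRecDepth 100000 in
lemma n_l2_hi : logHi sS (2 * sS) 430 ≤ n_l2 + 8192 := by decide +kernel

set_option maxRecDepth 100000 in
lemma n_l32_lo : n_l32 ≤ logLo sS (3 * sS / 2) 300 := by decide +kernel

set_option maxRecDepth 100000 in
lemma n_l32_hi : logHi sS (3 * sS / 2) 300 ≤ n_l32 + 8192 := by decide +kernel

set_option maxRecDepth 100000 in
lemma n_l54_lo : n_l54 ≤ logLo sS (5 * sS / 4) 220 := by decide +kernel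

set_option maxRecDepth 100000 in
lemma n_l54_hi : logHi sS (5 * sS / 4) 220 ≤ n_l54 + 8192 := by decide +kernel

set_option maxRecDepth 100000 in
lemma n_l87_lo : n_l87 ≤ logLo sS (8 * sS / 7) 180 := by decide +kernel

set_option maxRecDepth 100000 in
lemma n_l87_hi : logHi sS (8 * sS / 7 + 1) 180 ≤ n_l87 + 8192 := by decide +kernel

set_option maxRecDepth 100000 in
lemma n_lr_lo : n_lr ≤ logLo sS sR 260 := by decide +kernel

set_option maxRecDepth 100000 in
lemma n_lr_hi : logHi sS (sR + 1) 260 ≤ n_lr + 8192 := by decide +kernel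

set_option maxRecDepth 100000 in
lemma n_lb_lo : n_lb ≤ logLo sS ((3 * sR ^ 2 / sS - sS) / 4) 180 := by decide +kernel

set_option maxRecDepth 100000 in
lemma n_lb_hi : logHi sS ((3 * (sR + 1) ^ 2 / sS + 1 - sS) / 4 + 1) 180 ≤ n_lb + 8192 := by decide +kernel

set_option maxRecDepth 100000 in
lemma sR_lo : sR ^ 3 ≤ sR * sS ^ 2 + sS ^ 3 := by decide +kernel

set_option maxRecDepth 100000 in
lemma sR_hi : (sR + 1) * sS ^ 2 + sS ^ 3 ≤ (sR + 1) ^ 3 := by decide +kernel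


lemma sS_pos : 0 < sS := by unfold sS; positivity
lemma sS_posR : (0 : ℝ) < sS := by exact_mod_cast sS_pos

lemma pr_mono_aux (x y : ℝ) (hx : 1 ≤ x) (hy : 1 ≤ y) (h : x ^ 3 - x ≤ y ^ 3 - y) : x ≤ y := by
  by_contra hlt
  push Not at hlt
  nlinarith [mul_pos (sub_pos.2 hlt) (by nlinarith : 0 < x ^ 2 + x * y + y ^ 2 - 1)]

set_option maxRecDepth 100000 in
lemma sR_ge : sS ≤ sR := by decide +kernel

lemma cube_div_aux (R S : ℝ) (hS : 0 < S) : (R / S) ^ 3 - R / S = (R ^ 3 - R * S ^ 2) / S ^ 3 := by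
  field_simp

lemma sq_aux (R S r : ℝ) (hR : 0 ≤ R) (h : R ≤ S * r) : 3 * R ^ 2 ≤ S * (3 * r ^ 2) * S := by
  have h4 : R ^ 2 ≤ (S * r) ^ 2 := by gcongr
  nlinarith

lemma sq_aux2 (R S r : ℝ) (hR : 0 ≤ S * r) (h : S * r ≤ R) : S * (3 * r ^ 2) * S ≤ 3 * R ^ 2 := by
  have h4 : (S * r) ^ 2 ≤ R ^ 2 := by gcongr
  nlinarith

lemma sR_le_pr : (sR : ℝ) ≤ sS * pr := by
  have hS := sS_posR
  have h0 : (sS : ℝ) ≤ sR := by exact_mod_cast sR_ge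
  have h1 : (sR : ℝ) ^ 3 ≤ sR * sS ^ 2 + sS ^ 3 := by exact_mod_cast sR_lo
  have h2 : (sR : ℝ) / sS ≤ pr := by
    apply pr_mono_aux _ _ ((one_le_div hS).2 h0) (by linarith [pr_lb])
    rw [pr_cube]
    rw [cube_div_aux _ _ hS, div_le_iff₀ (by positivity)]
    linarith
  rw [div_le_iff₀ hS] at h2
  linarith

lemma pr_le_sR : sS * pr ≤ ((sR + 1 : ℕ) : ℝ) := by
  have hS := sS_posR
  have h0 : (sS : ℝ) ≤ ((sR + 1 : ℕ) : ℝ) := by exact_mod_cast sR_ge.trans (Nat.le_succ _)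
  have h1 : ((sR + 1 : ℕ) : ℝ) * sS ^ 2 + sS ^ 3 ≤ ((sR + 1 : ℕ) : ℝ) ^ 3 := by exact_mod_cast sR_hi
  generalize ((sR + 1 : ℕ) : ℝ) = R at *
  have h2 : pr ≤ R / sS := by
    apply pr_mono_aux _ _ (by linarith [pr_lb]) ((one_le_div hS).2 h0)
    rw [pr_cube]
    rw [cube_div_aux _ _ hS, le_div_iff₀ (by positivity)]
    linarith
  rw [le_div_iff₀ hS] at h2
  linarith

set_option maxRecDepth 100000 in
lemma pbA_ge : sS ≤ (3 * sR ^ 2 / sS - sS) / 4 := by decide +kernel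
set_option maxRecDepth 100000 in
lemma pbA_ge2 : sS ≤ (3 * (sR + 1) ^ 2 / sS + 1 - sS) / 4 + 1 := by decide +kernel
set_option maxRecDepth 100000 in
lemma pbA_ge3 : sS ≤ 3 * sR ^ 2 / sS := by decide +kernel
set_option maxRecDepth 100000 in
lemma pbA_ge4 : sS ≤ 3 * (sR + 1) ^ 2 / sS + 1 := by decide +kernel

lemma pbA_lo : (((3 * sR ^ 2 / sS - sS) / 4 : ℕ) : ℝ) ≤ sS * (pb / 4) := by
  have hS := sS_posR
  refine (nat_div_le_real _ _).trans ?_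
  rw [Nat.cast_sub pbA_ge3]
  have h1 := nat_div_le_real (3 * sR ^ 2) sS
  have h2 : ((3 * sR ^ 2 : ℕ) : ℝ) / sS ≤ sS * (3 * pr ^ 2) := by
    rw [div_le_iff₀ hS]
    push_cast
    exact sq_aux _ _ _ (Nat.cast_nonneg _) sR_le_pr
  have h5 : (sS : ℝ) * (pb / 4) = (sS * (3 * pr ^ 2) - sS) / 4 := by unfold pb; ring
  rw [h5]
  push_cast at h1 h2 ⊢
  gcongr
  linarith

lemma pbA_hi : sS * (pb / 4) ≤ (((3 * (sR + 1) ^ 2 / sS + 1 - sS) / 4 + 1 : ℕ) : ℝ) := by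
  have hS := sS_posR
  refine le_trans ?_ (real_le_nat_div _ _ (by norm_num))
  rw [Nat.cast_sub pbA_ge4]
  have h1 := real_le_nat_div (3 * (sR + 1) ^ 2) sS sS_pos
  have h2 : sS * (3 * pr ^ 2) ≤ ((3 * (sR + 1) ^ 2 : ℕ) : ℝ) / sS := by
    rw [le_div_iff₀ hS]
    have h3 := sq_aux2 _ _ _ (mul_nonneg hS.le pr_pos.le) pr_le_sR
    rw [Nat.cast_mul, Nat.cast_pow]
    exact_mod_cast h3
  have h5 : (sS : ℝ) * (pb / 4) = (sS * (3 * pr ^ 2) - sS) / 4 := by unfold pb; ring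
  rw [h5]
  have h7 := h2.trans h1
  have h8 : ((4 : ℕ) : ℝ) = 4 := by norm_num
  rw [h8]
  gcongr

lemma b_l2 : (n_l2 : ℝ) ≤ sS * Real.log 2 ∧ sS * Real.log 2 ≤ n_l2 + 8192 := by
  have hS := sS_pos
  constructor
  · exact le_trans (by exact_mod_cast n_l2_lo)
      (logLo_le sS (2 * sS) 430 2 hS (by omega) (by push_cast; linarith))
  · refine le_trans (logHi_ge sS (2 * sS) 430 2 hS (by omega) (by norm_num) (by norm_num)
      (by push_cast; linarith)) (by exact_mod_cast n_l2_hi)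

set_option maxRecDepth 100000 in
lemma aux32 : 2 * (3 * sS / 2) = 3 * sS := by decide +kernel
set_option maxRecDepth 100000 in
lemma aux54 : 4 * (5 * sS / 4) = 5 * sS := by decide +kernel

lemma b_l32 : (n_l32 : ℝ) ≤ sS * Real.log (3 / 2) ∧ sS * Real.log (3 / 2) ≤ n_l32 + 8192 := by
  have hS := sS_pos
  have h1 : (2 : ℝ) * ((3 * sS / 2 : ℕ) : ℝ) = 3 * sS := by exact_mod_cast aux32
  have h2 := aux32
  constructor
  · exact le_trans (by exact_mod_cast n_l32_lo)
      (logLo_le sS (3 * sS / 2) 300 (3 / 2) hS (by omega) (by linarith))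
  · refine le_trans (logHi_ge sS (3 * sS / 2) 300 (3 / 2) hS (by omega) (by norm_num) (by norm_num)
      (by linarith)) (by exact_mod_cast n_l32_hi)

lemma b_l54 : (n_l54 : ℝ) ≤ sS * Real.log (5 / 4) ∧ sS * Real.log (5 / 4) ≤ n_l54 + 8192 := by
  have hS := sS_pos
  have h1 : (4 : ℝ) * ((5 * sS / 4 : ℕ) : ℝ) = 5 * sS := by exact_mod_cast aux54
  have h2 := aux54
  constructor
  · exact le_trans (by exact_mod_cast n_l54_lo)
      (logLo_le sS (5 * sS / 4) 220 (5 / 4) hS (by omega) (by linarith))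
  · refine le_trans (logHi_ge sS (5 * sS / 4) 220 (5 / 4) hS (by omega) (by norm_num) (by norm_num)
      (by linarith)) (by exact_mod_cast n_l54_hi)

lemma b_l87 : (n_l87 : ℝ) ≤ sS * Real.log (8 / 7) ∧ sS * Real.log (8 / 7) ≤ n_l87 + 8192 := by
  have hS := sS_pos
  have h1 := nat_div_le_real (8 * sS) 7
  have h2 := real_le_nat_div (8 * sS) 7 (by norm_num)
  rw [Nat.cast_mul] at h1 h2
  have h3 : ((8 : ℕ) : ℝ) = 8 := by norm_num
  have h4 : ((7 : ℕ) : ℝ) = 7 := by norm_num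
  rw [h3, h4] at h1 h2
  constructor
  · exact le_trans (by exact_mod_cast n_l87_lo)
      (logLo_le sS (8 * sS / 7) 180 (8 / 7) hS (by omega) (by linarith))
  · refine le_trans (logHi_ge sS (8 * sS / 7 + 1) 180 (8 / 7) hS (by omega) (by norm_num)
      (by norm_num) (by linarith)) (by exact_mod_cast n_l87_hi)

lemma b_lr : (n_lr : ℝ) ≤ sS * Real.log pr ∧ sS * Real.log pr ≤ n_lr + 8192 := by
  have hS := sS_pos
  have h0 := sR_ge
  constructor
  · exact le_trans (by exact_mod_cast n_lr_lo) (logLo_le sS sR 260 pr hS h0 sR_le_pr)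
  · refine le_trans (logHi_ge sS (sR + 1) 260 pr hS (by omega) (by linarith [pr_lb])
      (by linarith [pr_ub]) pr_le_sR) (by exact_mod_cast n_lr_hi)

lemma b_lb : (n_lb : ℝ) ≤ sS * Real.log (pb / 4) ∧ sS * Real.log (pb / 4) ≤ n_lb + 8192 := by
  have hS := sS_pos
  constructor
  · exact le_trans (by exact_mod_cast n_lb_lo) (logLo_le sS _ 180 (pb / 4) hS pbA_ge pbA_lo)
  · refine le_trans (logHi_ge sS _ 180 (pb / 4) hS pbA_ge2 (by linarith [pb_lb])
      (by linarith [pb_ub]) pbA_hi) (by exact_mod_cast n_lb_hi)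


lemma log_dig (d : ℕ) (hd : 0 < d) :
    Real.log (al3 d) = Real.log d + Real.log (pb / 4) - 2 * Real.log (3 / 2) := by
  have h1 : al3 d = d * (pb / 4) / (3 / 2) ^ 2 := by unfold al3; ring
  have hd' : (d : ℝ) ≠ 0 := by positivity
  have hp : pb / 4 ≠ 0 := by have := pb_lb; positivity
  rw [h1, Real.log_div (by positivity) (by norm_num), Real.log_mul hd' hp, Real.log_pow]
  norm_num

lemma log_vals : Real.log 3 = Real.log 2 + Real.log (3 / 2) ∧
    Real.log 4 = 2 * Real.log 2 ∧
    Real.log 5 = 2 * Real.log 2 + Real.log (5 / 4) ∧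
    Real.log 6 = 2 * Real.log 2 + Real.log (3 / 2) ∧
    Real.log 7 = 3 * Real.log 2 - Real.log (8 / 7) ∧
    Real.log 8 = 3 * Real.log 2 ∧
    Real.log 9 = 2 * Real.log 2 + 2 * Real.log (3 / 2) ∧
    Real.log 10 = 3 * Real.log 2 + Real.log (5 / 4) := by
  have h4 : Real.log 4 = 2 * Real.log 2 := by
    rw [show (4 : ℝ) = 2 ^ 2 by norm_num, Real.log_pow]; norm_num
  have h8 : Real.log 8 = 3 * Real.log 2 := by
    rw [show (8 : ℝ) = 2 ^ 3 by norm_num, Real.log_pow]; norm_num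
  have h32 : Real.log (3 / 2) = Real.log 3 - Real.log 2 := Real.log_div (by norm_num) (by norm_num)
  have h54 : Real.log (5 / 4) = Real.log 5 - Real.log 4 := Real.log_div (by norm_num) (by norm_num)
  have h87 : Real.log (8 / 7) = Real.log 8 - Real.log 7 := Real.log_div (by norm_num) (by norm_num)
  have h6 : Real.log 6 = Real.log 2 + Real.log 3 := by
    rw [show (6 : ℝ) = 2 * 3 by norm_num, Real.log_mul (by norm_num) (by norm_num)]
  have h9 : Real.log 9 = 2 * Real.log 3 := by
    rw [show (9 : ℝ) = 3 ^ 2 by norm_num, Real.log_pow]; norm_num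
  have h10 : Real.log 10 = Real.log 2 + Real.log 5 := by
    rw [show (10 : ℝ) = 2 * 5 by norm_num, Real.log_mul (by norm_num) (by norm_num)]
  refine ⟨?_, ?_, ?_, ?_, ?_, ?_, ?_, ?_⟩ <;> linarith

set_option exponentiation.threshold 2000 in
set_option maxRecDepth 100000 in
lemma bd_conv : |(qq : ℝ) * Real.log pr - qp * Real.log 10| * 2 ^ 600 ≤ 1 / 100 := by
  obtain ⟨-, -, -, -, -, -, -, h10⟩ := log_vals
  obtain ⟨a1, a2⟩ := b_l2
  obtain ⟨c1, c2⟩ := b_l54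
  obtain ⟨r1, r2⟩ := b_lr
  rw [h10]
  have hS : (sS : ℝ) = 2 ^ 1280 := by unfold sS; norm_num
  rw [hS] at a1 a2 c1 c2 r1 r2
  unfold n_l2 at a1 a2
  unfold n_l54 at c1 c2
  unfold n_lr at r1 r2
  unfold qq qp
  generalize Real.log 2 = a at *
  generalize Real.log (5 / 4) = c at *
  generalize Real.log pr = r at *
  rw [← le_div_iff₀ (by positivity), abs_le]
  norm_num at a1 a2 c1 c2 r1 r2 ⊢
  constructor <;> linarith

def kk1 : ℤ := -347556621751407652804498546901502166155662166115595995334719679106627014562573375127494406465500968168586094904848686949702737171918170838086352830810572871070241432493465968307206847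

set_option exponentiation.threshold 2000 in
set_option maxRecDepth 100000 in
lemma bd_1 : (kk1 : ℝ) * Real.log 10 + 51 / 100 ≤ qq * Real.log (al3 1) ∧
    qq * Real.log (al3 1) + 51 / 100 ≤ (kk1 + 1) * Real.log 10 := by
  obtain ⟨h3, h4, h5, h6, h7, h8, h9, h10⟩ := log_vals
  obtain ⟨a1, a2⟩ := b_l2
  obtain ⟨b1, b2⟩ := b_l32
  obtain ⟨c1, c2⟩ := b_l54
  obtain ⟨e1, e2⟩ := b_l87
  obtain ⟨f1, f2⟩ := b_lb
  have hl := log_dig 1 (by norm_num)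
  have hc : Real.log (((1 : ℕ) : ℝ)) = Real.log 1 := by norm_num
  rw [hc] at hl
  rw [Real.log_one] at hl
  rw [h10, hl]
  have hS : (sS : ℝ) = 2 ^ 1280 := by unfold sS; norm_num
  rw [hS] at a1 a2 b1 b2 c1 c2 e1 e2 f1 f2
  unfold n_l2 at a1 a2
  unfold n_l32 at b1 b2
  unfold n_l54 at c1 c2
  unfold n_l87 at e1 e2
  unfold n_lb at f1 f2
  unfold qq kk1
  clear hl hc h3 h4 h5 h6 h7 h8 h9 h10 hS
  generalize Real.log 2 = a at *
  generalize Real.log (3 / 2) = b at *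
  generalize Real.log (5 / 4) = c at *
  generalize Real.log (8 / 7) = e at *
  generalize Real.log (pb / 4) = f at *
  norm_num at a1 a2 b1 b2 c1 c2 e1 e2 f1 f2 ⊢
  constructor <;> linarith

def kk2 : ℤ := -24999292449606480268084623646543419084022739108261323827792414524318046568243550085278236268328026886258092934294873184709881364103746104532580925498301493897558444230261206804015090

set_option exponentiation.threshold 2000 in
set_option maxRecDepth 100000 in
lemma bd_2 : (kk2 : ℝ) * Real.log 10 + 51 / 100 ≤ qq * Real.log (al3 2) ∧
    qq * Real.log (al3 2) + 51 / 100 ≤ (kk2 + 1) * Real.log 10 := by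
  obtain ⟨h3, h4, h5, h6, h7, h8, h9, h10⟩ := log_vals
  obtain ⟨a1, a2⟩ := b_l2
  obtain ⟨b1, b2⟩ := b_l32
  obtain ⟨c1, c2⟩ := b_l54
  obtain ⟨e1, e2⟩ := b_l87
  obtain ⟨f1, f2⟩ := b_lb
  have hl := log_dig 2 (by norm_num)
  have hc : Real.log (((2 : ℕ) : ℝ)) = Real.log 2 := by norm_num
  rw [hc] at hl
  rw [h10, hl]
  have hS : (sS : ℝ) = 2 ^ 1280 := by unfold sS; norm_num
  rw [hS] at a1 a2 b1 b2 c1 c2 e1 e2 f1 f2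
  unfold n_l2 at a1 a2
  unfold n_l32 at b1 b2
  unfold n_l54 at c1 c2
  unfold n_l87 at e1 e2
  unfold n_lb at f1 f2
  unfold qq kk2
  clear hl hc h3 h4 h5 h6 h7 h8 h9 h10 hS
  generalize Real.log 2 = a at *
  generalize Real.log (3 / 2) = b at *
  generalize Real.log (5 / 4) = c at *
  generalize Real.log (8 / 7) = e at *
  generalize Real.log (pb / 4) = f at *
  norm_num at a1 a2 b1 b2 c1 c2 e1 e2 f1 f2 ⊢
  constructor <;> linarith

def kk3 : ℤ := 163684649524712600020950557903195089086200332685519178925547994340418081932234015806319989281231410894703722159867513545767020071791312404893410168900409488169681658439719849683657238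

set_option exponentiation.threshold 2000 in
set_option maxRecDepth 100000 in
lemma bd_3 : (kk3 : ℝ) * Real.log 10 + 51 / 100 ≤ qq * Real.log (al3 3) ∧
    qq * Real.log (al3 3) + 51 / 100 ≤ (kk3 + 1) * Real.log 10 := by
  obtain ⟨h3, h4, h5, h6, h7, h8, h9, h10⟩ := log_vals
  obtain ⟨a1, a2⟩ := b_l2
  obtain ⟨b1, b2⟩ := b_l32
  obtain ⟨c1, c2⟩ := b_l54
  obtain ⟨e1, e2⟩ := b_l87
  obtain ⟨f1, f2⟩ := b_lb
  have hl := log_dig 3 (by norm_num)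
  have hc : Real.log (((3 : ℕ) : ℝ)) = Real.log 3 := by norm_num
  rw [hc] at hl
  rw [h3] at hl
  rw [h10, hl]
  have hS : (sS : ℝ) = 2 ^ 1280 := by unfold sS; norm_num
  rw [hS] at a1 a2 b1 b2 c1 c2 e1 e2 f1 f2
  unfold n_l2 at a1 a2
  unfold n_l32 at b1 b2
  unfold n_l54 at c1 c2
  unfold n_l87 at e1 e2
  unfold n_lb at f1 f2
  unfold qq kk3
  clear hl hc h3 h4 h5 h6 h7 h8 h9 h10 hS
  generalize Real.log 2 = a at *
  generalize Real.log (3 / 2) = b at *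
  generalize Real.log (5 / 4) = c at *
  generalize Real.log (8 / 7) = e at *
  generalize Real.log (pb / 4) = f at *
  norm_num at a1 a2 b1 b2 c1 c2 e1 e2 f1 f2 ⊢
  constructor <;> linarith

def kk4 : ℤ := 297558036852194692268329299608415327987616687899073347679134850057990921426086274956937933928844914396069909036258940580282974443710678629021190979813969883275124544032943554699176667

set_option exponentiation.threshold 2000 in
set_option maxRecDepth 100000 in
lemma bd_4 : (kk4 : ℝ) * Real.log 10 + 51 / 100 ≤ qq * Real.log (al3 4) ∧
    qq * Real.log (al3 4) + 51 / 100 ≤ (kk4 + 1) * Real.log 10 := by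
  obtain ⟨h3, h4, h5, h6, h7, h8, h9, h10⟩ := log_vals
  obtain ⟨a1, a2⟩ := b_l2
  obtain ⟨b1, b2⟩ := b_l32
  obtain ⟨c1, c2⟩ := b_l54
  obtain ⟨e1, e2⟩ := b_l87
  obtain ⟨f1, f2⟩ := b_lb
  have hl := log_dig 4 (by norm_num)
  have hc : Real.log (((4 : ℕ) : ℝ)) = Real.log 4 := by norm_num
  rw [hc] at hl
  rw [h4] at hl
  rw [h10, hl]
  have hS : (sS : ℝ) = 2 ^ 1280 := by unfold sS; norm_num
  rw [hS] at a1 a2 b1 b2 c1 c2 e1 e2 f1 f2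
  unfold n_l2 at a1 a2
  unfold n_l32 at b1 b2
  unfold n_l54 at c1 c2
  unfold n_l87 at e1 e2
  unfold n_lb at f1 f2
  unfold qq kk4
  clear hl hc h3 h4 h5 h6 h7 h8 h9 h10 hS
  generalize Real.log 2 = a at *
  generalize Real.log (3 / 2) = b at *
  generalize Real.log (5 / 4) = c at *
  generalize Real.log (8 / 7) = e at *
  generalize Real.log (pb / 4) = f at *
  norm_num at a1 a2 b1 b2 c1 c2 e1 e2 f1 f2 ⊢
  constructor <;> linarith

def kk5 : ℤ := 401398303366279123561968250121775628650936778748537465559251290311573360256121733922765130617495397881955485036309071507154233034290632181080895982925249927198006062502858537738078624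

set_option exponentiation.threshold 2000 in
set_option maxRecDepth 100000 in
lemma bd_5 : (kk5 : ℝ) * Real.log 10 + 51 / 100 ≤ qq * Real.log (al3 5) ∧
    qq * Real.log (al3 5) + 51 / 100 ≤ (kk5 + 1) * Real.log 10 := by
  obtain ⟨h3, h4, h5, h6, h7, h8, h9, h10⟩ := log_vals
  obtain ⟨a1, a2⟩ := b_l2
  obtain ⟨b1, b2⟩ := b_l32
  obtain ⟨c1, c2⟩ := b_l54
  obtain ⟨e1, e2⟩ := b_l87
  obtain ⟨f1, f2⟩ := b_lb
  have hl := log_dig 5 (by norm_num)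
  have hc : Real.log (((5 : ℕ) : ℝ)) = Real.log 5 := by norm_num
  rw [hc] at hl
  rw [h5] at hl
  rw [h10, hl]
  have hS : (sS : ℝ) = 2 ^ 1280 := by unfold sS; norm_num
  rw [hS] at a1 a2 b1 b2 c1 c2 e1 e2 f1 f2
  unfold n_l2 at a1 a2
  unfold n_l32 at b1 b2
  unfold n_l54 at c1 c2
  unfold n_l87 at e1 e2
  unfold n_lb at f1 f2
  unfold qq kk5
  clear hl hc h3 h4 h5 h6 h7 h8 h9 h10 hS
  generalize Real.log 2 = a at *
  generalize Real.log (3 / 2) = b at *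
  generalize Real.log (5 / 4) = c at *
  generalize Real.log (8 / 7) = e at *
  generalize Real.log (pb / 4) = f at *
  norm_num at a1 a2 b1 b2 c1 c2 e1 e2 f1 f2 ⊢
  constructor <;> linarith

def kk6 : ℤ := 486241978826513772557364481158153836157839759692853850432475258922727049926563840848536159478404352177031724130421327310759875879605737138447182074212680865342364646702924611186848995

set_option exponentiation.threshold 2000 in
set_option maxRecDepth 100000 in
lemma bd_6 : (kk6 : ℝ) * Real.log 10 + 51 / 100 ≤ qq * Real.log (al3 6) ∧
    qq * Real.log (al3 6) + 51 / 100 ≤ (kk6 + 1) * Real.log 10 := by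
  obtain ⟨h3, h4, h5, h6, h7, h8, h9, h10⟩ := log_vals
  obtain ⟨a1, a2⟩ := b_l2
  obtain ⟨b1, b2⟩ := b_l32
  obtain ⟨c1, c2⟩ := b_l54
  obtain ⟨e1, e2⟩ := b_l87
  obtain ⟨f1, f2⟩ := b_lb
  have hl := log_dig 6 (by norm_num)
  have hc : Real.log (((6 : ℕ) : ℝ)) = Real.log 6 := by norm_num
  rw [hc] at hl
  rw [h6] at hl
  rw [h10, hl]
  have hS : (sS : ℝ) = 2 ^ 1280 := by unfold sS; norm_num
  rw [hS] at a1 a2 b1 b2 c1 c2 e1 e2 f1 f2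
  unfold n_l2 at a1 a2
  unfold n_l32 at b1 b2
  unfold n_l54 at c1 c2
  unfold n_l87 at e1 e2
  unfold n_lb at f1 f2
  unfold qq kk6
  clear hl hc h3 h4 h5 h6 h7 h8 h9 h10 hS
  generalize Real.log 2 = a at *
  generalize Real.log (3 / 2) = b at *
  generalize Real.log (5 / 4) = c at *
  generalize Real.log (8 / 7) = e at *
  generalize Real.log (pb / 4) = f at *
  norm_num at a1 a2 b1 b2 c1 c2 e1 e2 f1 f2 ⊢
  constructor <;> linarith

def kk7 : ℤ := 557976284309759319434269937412789459955170795307337165561886779027917492886212206060103747096095089888958202681711769899391686251465741682107144704552127870632523628425891672969853371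

set_option exponentiation.threshold 2000 in
set_option maxRecDepth 100000 in
lemma bd_7 : (kk7 : ℝ) * Real.log 10 + 51 / 100 ≤ qq * Real.log (al3 7) ∧
    qq * Real.log (al3 7) + 51 / 100 ≤ (kk7 + 1) * Real.log 10 := by
  obtain ⟨h3, h4, h5, h6, h7, h8, h9, h10⟩ := log_vals
  obtain ⟨a1, a2⟩ := b_l2
  obtain ⟨b1, b2⟩ := b_l32
  obtain ⟨c1, c2⟩ := b_l54
  obtain ⟨e1, e2⟩ := b_l87
  obtain ⟨f1, f2⟩ := b_lb
  have hl := log_dig 7 (by norm_num)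
  have hc : Real.log (((7 : ℕ) : ℝ)) = Real.log 7 := by norm_num
  rw [hc] at hl
  rw [h7] at hl
  rw [h10, hl]
  have hS : (sS : ℝ) = 2 ^ 1280 := by unfold sS; norm_num
  rw [hS] at a1 a2 b1 b2 c1 c2 e1 e2 f1 f2
  unfold n_l2 at a1 a2
  unfold n_l32 at b1 b2
  unfold n_l54 at c1 c2
  unfold n_l87 at e1 e2
  unfold n_lb at f1 f2
  unfold qq kk7
  clear hl hc h3 h4 h5 h6 h7 h8 h9 h10 hS
  generalize Real.log 2 = a at *
  generalize Real.log (3 / 2) = b at *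
  generalize Real.log (5 / 4) = c at *
  generalize Real.log (8 / 7) = e at *
  generalize Real.log (pb / 4) = f at *
  norm_num at a1 a2 b1 b2 c1 c2 e1 e2 f1 f2 ⊢
  constructor <;> linarith

def kk8 : ℤ := 620115366153995864804743222863374075059256114906408019186062114640299889420416099999154104126017855678397911006812754345275830251525103362574962885126241260447807532296148316202368424

set_option exponentiation.threshold 2000 in
set_option maxRecDepth 100000 in
lemma bd_8 : (kk8 : ℝ) * Real.log 10 + 51 / 100 ≤ qq * Real.log (al3 8) ∧
    qq * Real.log (al3 8) + 51 / 100 ≤ (kk8 + 1) * Real.log 10 := by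
  obtain ⟨h3, h4, h5, h6, h7, h8, h9, h10⟩ := log_vals
  obtain ⟨a1, a2⟩ := b_l2
  obtain ⟨b1, b2⟩ := b_l32
  obtain ⟨c1, c2⟩ := b_l54
  obtain ⟨e1, e2⟩ := b_l87
  obtain ⟨f1, f2⟩ := b_lb
  have hl := log_dig 8 (by norm_num)
  have hc : Real.log (((8 : ℕ) : ℝ)) = Real.log 8 := by norm_num
  rw [hc] at hl
  rw [h8] at hl
  rw [h10, hl]
  have hS : (sS : ℝ) = 2 ^ 1280 := by unfold sS; norm_num
  rw [hS] at a1 a2 b1 b2 c1 c2 e1 e2 f1 f2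
  unfold n_l2 at a1 a2
  unfold n_l32 at b1 b2
  unfold n_l54 at c1 c2
  unfold n_l87 at e1 e2
  unfold n_lb at f1 f2
  unfold qq kk8
  clear hl hc h3 h4 h5 h6 h7 h8 h9 h10 hS
  generalize Real.log 2 = a at *
  generalize Real.log (3 / 2) = b at *
  generalize Real.log (5 / 4) = c at *
  generalize Real.log (8 / 7) = e at *
  generalize Real.log (pb / 4) = f at *
  norm_num at a1 a2 b1 b2 c1 c2 e1 e2 f1 f2 ⊢
  constructor <;> linarith

def kk9 : ℤ := 674925920800832852846399662707892344328062831486634353185815667787463178427041406740134385027963789957993539224583714041236777315500795647873173168611391847409604749372905667674521323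

set_option exponentiation.threshold 2000 in
set_option maxRecDepth 100000 in
lemma bd_9 : (kk9 : ℝ) * Real.log 10 + 51 / 100 ≤ qq * Real.log (al3 9) ∧
    qq * Real.log (al3 9) + 51 / 100 ≤ (kk9 + 1) * Real.log 10 := by
  obtain ⟨h3, h4, h5, h6, h7, h8, h9, h10⟩ := log_vals
  obtain ⟨a1, a2⟩ := b_l2
  obtain ⟨b1, b2⟩ := b_l32
  obtain ⟨c1, c2⟩ := b_l54
  obtain ⟨e1, e2⟩ := b_l87
  obtain ⟨f1, f2⟩ := b_lb
  have hl := log_dig 9 (by norm_num)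
  have hc : Real.log (((9 : ℕ) : ℝ)) = Real.log 9 := by norm_num
  rw [hc] at hl
  rw [h9] at hl
  rw [h10, hl]
  have hS : (sS : ℝ) = 2 ^ 1280 := by unfold sS; norm_num
  rw [hS] at a1 a2 b1 b2 c1 c2 e1 e2 f1 f2
  unfold n_l2 at a1 a2
  unfold n_l32 at b1 b2
  unfold n_l54 at c1 c2
  unfold n_l87 at e1 e2
  unfold n_lb at f1 f2
  unfold qq kk9
  clear hl hc h3 h4 h5 h6 h7 h8 h9 h10 hS
  generalize Real.log 2 = a at *
  generalize Real.log (3 / 2) = b at *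
  generalize Real.log (5 / 4) = c at *
  generalize Real.log (8 / 7) = e at *
  generalize Real.log (pb / 4) = f at *
  norm_num at a1 a2 b1 b2 c1 c2 e1 e2 f1 f2 ⊢
  constructor <;> linarith

lemma bd_all (d : ℕ) (hd : 0 < d) (hd9 : d ≤ 9) : ∃ k : ℤ,
    (k : ℝ) * Real.log 10 + 51 / 100 ≤ qq * Real.log (al3 d) ∧
    qq * Real.log (al3 d) + 51 / 100 ≤ (k + 1) * Real.log 10 := by
  interval_cases d
  exacts [⟨_, bd_1⟩, ⟨_, bd_2⟩, ⟨_, bd_3⟩, ⟨_, bd_4⟩, ⟨_, bd_5⟩, ⟨_, bd_6⟩, ⟨_, bd_7⟩, ⟨_, bd_8⟩,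
    ⟨_, bd_9⟩]

lemma qq_lt : qq < 2 ^ 609 := by decide +kernel
lemma qq_pos : 0 < qq := by decide +kernel

set_option exponentiation.threshold 2000 in
theorem bd_bound (N m d : ℕ) (hN : N ≤ 2 ^ 600) (hd : 0 < d) (hd9 : d ≤ 9) :
    1 / 2 ≤ qq * |N * Real.log pr - m * Real.log 10 - Real.log (al3 d)| := by
  obtain ⟨k, hk1, hk2⟩ := bd_all d hd hd9
  have hc := bd_conv
  have hlt : 0 < Real.log 10 := Real.log_pos (by norm_num)
  generalize Real.log (al3 d) = la at *
  generalize Real.log 10 = lt at *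
  generalize Real.log pr = lr at *
  have hN' : (N : ℝ) ≤ 2 ^ 600 := by exact_mod_cast hN
  have hq : (0 : ℝ) ≤ qq := Nat.cast_nonneg _
  generalize hq' : (qq : ℝ) = q at *
  have h1 : |N * (q * lr - qp * lt)| ≤ 1 / 100 := by
    rw [abs_mul, Nat.abs_cast, mul_comm]
    refine le_trans ?_ hc
    gcongr
  rw [abs_le] at h1
  rw [← abs_of_nonneg hq, ← abs_mul]
  have h2 : q * (N * lr - m * lt - la) =
      N * (q * lr - qp * lt) + (((N * qp : ℤ) - qq * m : ℤ) : ℝ) * lt - q * la := by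
    push_cast
    rw [hq']
    ring
  rw [h2]
  generalize ((N * qp : ℤ) - qq * m : ℤ) = z at *
  rcases le_or_gt z k with hz | hz
  · have : (z : ℝ) ≤ k := by exact_mod_cast hz
    have h3 : (z : ℝ) * lt ≤ k * lt := by gcongr
    rw [abs_of_nonpos] <;> linarith
  · have : (k : ℝ) + 1 ≤ z := by exact_mod_cast hz
    have h3 : ((k : ℝ) + 1) * lt ≤ z * lt := by gcongr
    rw [abs_of_nonneg] <;> linarith


/-! ### Padovan numbers, Binet-type estimate and the linear form -/

lemma pad_rec (n : ℕ) : padovan (n + 3) = padovan (n + 1) + padovan n := by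
  rw [padovan]

lemma pad_quad (n : ℕ) : (padovan (n + 2) : ℝ) + pr * padovan (n + 1) + (pr ^ 2 - 1) * padovan n
    = pr ^ (n + 3) := by
  induction n with
  | zero => simp [padovan]; linarith [pr_cube]
  | succ n ih =>
    rw [show n + 1 + 2 = n + 3 by ring, pad_rec, show n + 1 + 3 = (n + 3) + 1 by ring, pow_succ _ (n + 3), ← ih]
    push_cast
    linear_combination -(padovan n : ℝ) * pr_cube

noncomputable def pE (n : ℕ) : ℝ := pb * padovan n - pr ^ (n + 3)

lemma pE_rec (n : ℕ) : pE (n + 2) + pr * pE (n + 1) + (pr ^ 2 - 1) * pE n = 0 := by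
  have h := pad_quad n
  have h3 := pr_cube
  unfold pE pb
  have h5 : pr ^ (n + 2 + 3) = pr ^ (n + 3) * pr ^ 2 := by ring
  have h6 : pr ^ (n + 1 + 3) = pr ^ (n + 3) * pr := by ring
  rw [h5, h6]
  linear_combination (3 * pr ^ 2 - 1) * h

lemma pV_bound (n : ℕ) :
    pE (n + 1) ^ 2 + pr * pE (n + 1) * pE n + (pr ^ 2 - 1) * pE n ^ 2 ≤ 10 := by
  induction n with
  | zero =>
    have h0 : pE 0 = - (pr + 1) := by simp [pE, padovan]; linarith [pr_cube]
    have h1 : pE 1 = pb - (pr + 1) * pr := by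
      simp [pE, padovan]; rw [← pr_cube]; ring
    rw [zero_add, h0, h1]
    unfold pb
    nlinarith [pr_lb, pr_ub, pr_cube]
  | succ n ih =>
    have h := pE_rec n
    have h1 : pE (n + 2) = - pr * pE (n + 1) - (pr ^ 2 - 1) * pE n := by linarith
    rw [show n + 1 + 1 = n + 2 by ring, h1]
    have hV : (-pr * pE (n + 1) - (pr ^ 2 - 1) * pE n) ^ 2 +
        pr * (-pr * pE (n + 1) - (pr ^ 2 - 1) * pE n) * pE (n + 1) + (pr ^ 2 - 1) * pE (n + 1) ^ 2 =
        (pr ^ 2 - 1) * (pE (n + 1) ^ 2 + pr * pE (n + 1) * pE n + (pr ^ 2 - 1) * pE n ^ 2) := by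
      ring
    rw [hV]
    have h2 : 0 < pr ^ 2 - 1 := by nlinarith [pr_lb]
    have h3 : pr ^ 2 - 1 ≤ 1 := by nlinarith [pr_ub, pr_lb]
    nlinarith

lemma pE_bound (n : ℕ) : |pE n| ≤ 6 := by
  have h := pV_bound n
  have h1 : pE (n + 1) ^ 2 + pr * pE (n + 1) * pE n + (pr ^ 2 - 1) * pE n ^ 2 =
    (pE (n + 1) + pr / 2 * pE n) ^ 2 + (3 / 4 * pr ^ 2 - 1) * pE n ^ 2 := by ring
  have h2 : 0.3 ≤ 3 / 4 * pr ^ 2 - 1 := by nlinarith [pr_lb]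
  have h3 : 0.3 * pE n ^ 2 ≤ (3 / 4 * pr ^ 2 - 1) * pE n ^ 2 := by gcongr
  apply abs_le_of_sq_le_sq _ (by norm_num)
  nlinarith [sq_nonneg (pE (n + 1) + pr / 2 * pE n)]

lemma ten_rep (l : ℕ) : 9 * ((10 ^ l - 1) / 9) = 10 ^ l - 1 := by
  have h : 9 ∣ 10 ^ l - 1 := by
    have := Nat.sub_dvd_pow_sub_pow 10 1 l
    simpa using this
  exact Nat.mul_div_cancel' h

lemma eq_nat (n d₁ d₂ l₁ l₂ : ℕ)
    (h : padovan n = d₁ * ((10 ^ l₁ - 1) / 9) * 10 ^ l₂ + d₂ * ((10 ^ l₂ - 1) / 9)) :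
    9 * padovan n + d₁ * 10 ^ l₂ + d₂ = d₁ * 10 ^ (l₁ + l₂) + d₂ * 10 ^ l₂ := by
  have h1 := ten_rep l₁
  have h2 := ten_rep l₂
  have p1 : 1 ≤ 10 ^ l₁ := Nat.one_le_pow _ _ (by norm_num)
  have p2 : 1 ≤ 10 ^ l₂ := Nat.one_le_pow _ _ (by norm_num)
  generalize (10 ^ l₁ - 1) / 9 = u at *
  generalize (10 ^ l₂ - 1) / 9 = v at *
  have e1 : 10 ^ l₁ = 9 * u + 1 := by omega
  have e2 : 10 ^ l₂ = 9 * v + 1 := by omega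
  rw [h, pow_add, e1, e2]
  ring

lemma log_near (x δ : ℝ) (hδ : δ ≤ 1 / 2) (h : |x - 1| ≤ δ) : |Real.log x| ≤ 2 * δ := by
  rw [abs_le] at h
  have hx : 1 / 2 ≤ x := by linarith
  have hx0 : 0 < x := by linarith
  have h1 := Real.log_le_sub_one_of_pos hx0
  have h2 := Real.one_sub_inv_le_log_of_pos hx0
  have h3 : x⁻¹ ≤ 1 + 2 * δ := by
    rw [inv_le_iff_one_le_mul₀ hx0]
    nlinarith
  rw [abs_le]
  constructor <;> linarith

lemma lin_form (n d₁ d₂ l₁ l₂ : ℕ) (hd1 : 0 < d₁) (hd19 : d₁ ≤ 9) (hd2 : d₂ ≤ 9) (hl1 : 2 ≤ l₁)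
    (hl2 : 1 ≤ l₂)
    (h : 9 * padovan n + d₁ * 10 ^ l₂ + d₂ = d₁ * 10 ^ (l₁ + l₂) + d₂ * 10 ^ l₂) :
    |((n + 3 : ℕ) : ℝ) * Real.log pr - ((l₁ + l₂ : ℕ) : ℝ) * Real.log 10 - Real.log (al3 d₁)| * 10 ^ l₁
      ≤ 24 := by
  have hE := pE_bound n
  have ha := al3_pos d₁ hd1
  have hR : (9 : ℝ) * padovan n + d₁ * 10 ^ l₂ + d₂ = d₁ * 10 ^ (l₁ + l₂) + d₂ * 10 ^ l₂ := by
    exact_mod_cast h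
  have hlog : ((n + 3 : ℕ) : ℝ) * Real.log pr - ((l₁ + l₂ : ℕ) : ℝ) * Real.log 10 - Real.log (al3 d₁)
      = Real.log (pr ^ (n + 3) / 10 ^ (l₁ + l₂) / al3 d₁) := by
    have hp := pr_pos
    rw [Real.log_div (by positivity) ha.ne', Real.log_div (by positivity) (by positivity),
      Real.log_pow, Real.log_pow]
  rw [hlog]
  have hT1 : (100 : ℝ) ≤ 10 ^ l₁ := by
    calc (100 : ℝ) = 10 ^ 2 := by norm_num
      _ ≤ 10 ^ l₁ := pow_le_pow_right₀ (by norm_num) hl1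
  have hT2 : (10 : ℝ) ≤ 10 ^ l₂ := by
    calc (10 : ℝ) = 10 ^ 1 := by norm_num
      _ ≤ 10 ^ l₂ := pow_le_pow_right₀ (by norm_num) hl2
  have hx : pr ^ (n + 3) = pb * padovan n - pE n := by unfold pE; ring
  rw [pow_add (10 : ℝ)] at hR ⊢
  generalize (10 : ℝ) ^ l₁ = A at *
  generalize (10 : ℝ) ^ l₂ = B at *
  have hb1 := pb_lb
  have hb2 := pb_ub
  have hd1' : (1 : ℝ) ≤ d₁ := by exact_mod_cast hd1
  have hd19' : (d₁ : ℝ) ≤ 9 := by exact_mod_cast hd19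
  have hd2' : (d₂ : ℝ) ≤ 9 := by exact_mod_cast hd2
  have hd20 : (0 : ℝ) ≤ d₂ := Nat.cast_nonneg _
  have hA : 0 < A := by linarith
  have hB : 0 < B := by linarith
  have key : |pr ^ (n + 3) / (A * B) / al3 d₁ - 1| ≤ 12 / A := by
    have e : pr ^ (n + 3) / (A * B) / al3 d₁ - 1 =
        (-pb * ((d₁ - d₂) * B + d₂) - 9 * pE n) / (d₁ * pb * A * B) := by
      rw [hx]
      have : (padovan n : ℝ) = (d₁ * (A * B) + d₂ * B - d₁ * B - d₂) / 9 := by linarith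
      rw [this]
      unfold al3
      have : pb ≠ 0 := by linarith
      field_simp
      ring
    rw [e, abs_div, abs_of_pos (by positivity : 0 < (d₁ : ℝ) * pb * A * B),
      div_le_div_iff₀ (by positivity) hA]
    have h1 : |-pb * ((d₁ - d₂) * B + d₂) - 9 * pE n| ≤ 12 * (pb * B) := by
      rw [abs_le] at hE ⊢
      have g1 : |((d₁ : ℝ) - d₂) * B| ≤ 9 * B := by
        rw [abs_mul, abs_of_pos hB]
        gcongr
        rw [abs_le]; constructor <;> linarith
      rw [abs_le] at g1
      have g2 : -(10 * B) ≤ ((d₁ : ℝ) - d₂) * B + d₂ := by linarith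
      have g3 : ((d₁ : ℝ) - d₂) * B + d₂ ≤ 10 * B := by linarith
      have g4 := mul_le_mul_of_nonneg_left g2 (by linarith : 0 ≤ pb)
      have g5 := mul_le_mul_of_nonneg_left g3 (by linarith : 0 ≤ pb)
      have g6 : 54 ≤ 2 * (pb * B) := by nlinarith
      constructor <;> nlinarith
    calc _ ≤ 12 * (pb * B) * A := by gcongr
      _ ≤ 12 * (d₁ * pb * A * B) := by
        have : 0 ≤ (pb * A * B) := by positivity
        nlinarith
  have := log_near _ (12 / A) (by rw [div_le_div_iff₀ hA (by norm_num)]; linarith) key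
  calc _ ≤ 2 * (12 / A) * A := by gcongr
    _ = 24 := by field_simp; norm_num

lemma pad_pos (n : ℕ) : 0 < padovan (n + 1) ∧ 0 < padovan (n + 2) ∧ 0 < padovan (n + 3) := by
  induction n with
  | zero => simp [padovan]
  | succ n ih => 
    refine ⟨ih.2.1, ih.2.2, ?_⟩
    rw [pad_rec (n + 1)]
    have := ih.2.1
    omega

lemma pad_lt (n : ℕ) : padovan n ≤ 2 ^ n ∧ padovan (n + 1) ≤ 2 ^ n ∧ padovan (n + 2) ≤ 2 ^ n := by
  induction n with
  | zero => simp [padovan]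
  | succ n ih =>
    have h1 : 1 ≤ 2 ^ n := Nat.one_le_two_pow
    rw [pow_succ, show n + 1 + 2 = n + 3 by ring, pad_rec]
    refine ⟨?_, ?_, ?_⟩ <;> [skip; rw [show n + 1 + 1 = n + 2 by ring]; skip] <;> omega

/-- doubling every three steps -/
lemma pad_ge (k : ℕ) : 2 ^ k ≤ padovan (3 * k + 5) ∧ 2 ^ k ≤ padovan (3 * k + 6) ∧
    2 ^ k ≤ padovan (3 * k + 7) ∧ padovan (3 * k + 5) ≤ padovan (3 * k + 6) ∧
    padovan (3 * k + 6) ≤ padovan (3 * k + 7) := by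
  induction k with
  | zero => simp [padovan]
  | succ k ih =>
    have e8 := pad_rec (3 * k + 5)
    have e9 := pad_rec (3 * k + 6)
    have e10 := pad_rec (3 * k + 7)
    simp only [Nat.add_assoc, Nat.reduceAdd, Nat.mul_add, Nat.mul_one, pow_succ] at *
    omega

lemma pad_ge' (n : ℕ) (hn : 5 ≤ n) : 2 ^ ((n - 5) / 3) ≤ padovan n := by
  obtain ⟨h1, h2, h3, -, -⟩ := pad_ge ((n - 5) / 3)
  have hr : n = 3 * ((n - 5) / 3) + 5 ∨ n = 3 * ((n - 5) / 3) + 6 ∨ n = 3 * ((n - 5) / 3) + 7 := by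
    omega
  generalize (n - 5) / 3 = k at *
  rcases hr with rfl | rfl | rfl <;> assumption


/-! ### Congruences: bounding the second block when its digit is nonzero -/

def pst (M : ℕ) : ℕ → ℕ × ℕ × ℕ
  | 0 => (0 % M, 1 % M, 1 % M)
  | n + 1 => ((pst M n).2.1, (pst M n).2.2, ((pst M n).1 + (pst M n).2.1) % M)

lemma pst_eq (M n : ℕ) :
    pst M n = (padovan n % M, padovan (n + 1) % M, padovan (n + 2) % M) := by
  induction n with
  | zero => simp [pst, padovan]
  | succ n ih =>
    simp only [pst, ih]
    rw [show n + 1 + 2 = n + 3 by ring, pad_rec, ← Nat.add_mod, add_comm (padovan n)]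

lemma pad_period (M T : ℕ) (h : pst M T = pst M 0) (n : ℕ) :
    padovan (n + T) % M = padovan n % M ∧ padovan (n + 1 + T) % M = padovan (n + 1) % M ∧
    padovan (n + 2 + T) % M = padovan (n + 2) % M := by
  induction n with
  | zero =>
    rw [pst_eq, pst_eq] at h
    simp only [Prod.mk.injEq] at h
    simpa [add_comm] using h
  | succ n ih =>
    refine ⟨ih.2.1, ih.2.2, ?_⟩
    rw [show n + 1 + 2 + T = (n + T) + 3 by ring, show n + 1 + 2 = n + 3 by ring, pad_rec, pad_rec,
      show n + T + 1 = n + 1 + T by ring, Nat.add_mod, ih.1, ih.2.1, ← Nat.add_mod]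

lemma pad_mod (M T : ℕ) (h : pst M T = pst M 0) (n : ℕ) :
    padovan n % M = padovan (n % T) % M := by
  have h1 : ∀ k r, padovan (r + k * T) % M = padovan r % M := by
    intro k r
    induction k with
    | zero => simp
    | succ k ih => rw [Nat.succ_mul, ← add_assoc, (pad_period M T h _).1, ih]
  conv_lhs => rw [← Nat.mod_add_div n T, mul_comm T]
  exact h1 _ _

def ploop (M : ℕ) (chk : ℕ → ℕ → Bool) : ℕ → ℕ → ℕ → ℕ → ℕ → Bool
  | 0, _, _, _, _ => true
  | f + 1, n, a, b, c => chk n a && ploop M chk f (n + 1) b c ((a + b) % M)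

lemma ploop_spec (M : ℕ) (chk : ℕ → ℕ → Bool) (f : ℕ) : ∀ n,
    ploop M chk f n (padovan n % M) (padovan (n + 1) % M) (padovan (n + 2) % M) = true →
    ∀ i, n ≤ i → i < n + f → chk i (padovan i % M) = true := by
  induction f with
  | zero => intro n _ i h1 h2; omega
  | succ f ih =>
    intro n h i h1 h2
    simp only [ploop, Bool.and_eq_true] at h
    rcases Nat.eq_or_lt_of_le h1 with rfl | h3
    · exact h.1
    · refine ih (n + 1) ?_ i h3 (by omega)
      rw [show n + 1 + 2 = n + 3 by ring, pad_rec, Nat.add_mod, add_comm (padovan (n + 1) % M)]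
      rw [show n + 1 + 1 = n + 2 by ring]
      exact h.2

lemma ploop_zero (M : ℕ) (chk : ℕ → ℕ → Bool) (f : ℕ) (h : ploop M chk f 0 0 (1 % M) (1 % M) = true)
    (i : ℕ) (hi : i < f) : chk i (padovan i % M) = true := by
  refine ploop_spec M chk f 0 ?_ i (Nat.zero_le _) (by omega)
  simpa [padovan] using h

def inA (d r : ℕ) : Bool :=
  match d with
  | 1 => r == 1 || r == 4 || r == 5
  | 2 => r == 6
  | 3 => r == 0 || r == 5 || r == 7
  | 4 => r == 3 || r == 6
  | 5 => r == 6
  | 6 => r == 0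
  | 7 => r == 0 || r == 1 || r == 2 || r == 6 || r == 7
  | 8 => r == 1 || r == 4 || r == 5
  | _ => r == 0 || r == 3

def chkA (n a : ℕ) : Bool :=
  (List.range 9).all fun d => !((9 * a + (d + 1)) % 256 == 0) || inA (d + 1) (n % 8)

def chkB (n a : ℕ) : Bool :=
  (List.range 9).all fun d => !((9 * a + (d + 1)) % 125 == 0) || !inA (d + 1) (n % 8) ||
    (List.range 9).all fun e => e == d || (List.range 4).all fun u => (List.range 4).all fun v =>
      !((9 * a + (e + 1) * 10 ^ v + (d + 1)) % 1111 ==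
        ((e + 1) * 10 ^ (u + v) + (d + 1) * 10 ^ v) % 1111)

set_option maxRecDepth 100000 in
lemma per256 : pst 256 896 = pst 256 0 := by decide +kernel
set_option maxRecDepth 100000 in
lemma per600 : pst 138875 600 = pst 138875 0 := by decide +kernel
set_option maxRecDepth 100000 in
lemma loopA : ploop 256 chkA 896 0 0 1 1 = true := by decide +kernel
set_option maxRecDepth 100000 in
lemma loopB : ploop 138875 chkB 600 0 0 1 1 = true := by decide +kernel

lemma ten_mod (k : ℕ) : 10 ^ k ≡ 10 ^ (k % 4) [MOD 1111] := by
  conv_lhs => rw [← Nat.mod_add_div k 4, pow_add, pow_mul]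
  have : (10 ^ 4) ^ (k / 4) ≡ 1 ^ (k / 4) [MOD 1111] := Nat.ModEq.pow _ (by decide)
  simpa using (Nat.ModEq.refl (10 ^ (k % 4))).mul this

lemma part_A1 (n d₁ d₂ l₁ l₂ : ℕ) (hd1 : 0 < d₁) (hd19 : d₁ ≤ 9) (hd2 : d₂ ≤ 9) (hd20 : 0 < d₂)
    (hne : d₁ ≠ d₂)
    (h : 9 * padovan n + d₁ * 10 ^ l₂ + d₂ = d₁ * 10 ^ (l₁ + l₂) + d₂ * 10 ^ l₂) : l₂ ≤ 7 := by
  by_contra hl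
  have hl8 : 8 ≤ l₂ := by omega
  obtain ⟨d, rfl⟩ : ∃ d, d₂ = d + 1 := ⟨d₂ - 1, by omega⟩
  obtain ⟨e, rfl⟩ : ∃ e, d₁ = e + 1 := ⟨d₁ - 1, by omega⟩
  have hA := ploop_zero 256 chkA 896 loopA (n % 896) (Nat.mod_lt _ (by norm_num))
  have hB := ploop_zero 138875 chkB 600 loopB (n % 600) (Nat.mod_lt _ (by norm_num))
  rw [← pad_mod 256 896 per256] at hA
  rw [← pad_mod 138875 600 per600] at hB
  simp only [chkA, chkB, List.all_eq_true, List.mem_range, Bool.or_eq_true, Bool.not_eq_true',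
    beq_eq_false_iff_ne, beq_iff_eq] at hA hB
  have hA' := hA d (by omega)
  have hB' := hB d (by omega)
  obtain ⟨t, ht⟩ : 10 ^ 8 ∣ 10 ^ l₂ := pow_dvd_pow _ hl8
  have h4 : (9 * padovan n + (d + 1)) % 10 ^ 8 = 0 := by
    have hz : ((9 * padovan n + (d + 1) : ℕ) : ℤ) = 10 ^ 8 * (t * ((e + 1) * 10 ^ l₁ + (d + 1) - (e + 1))) := by
      have hz2 : ((9 * padovan n + (e + 1) * 10 ^ l₂ + (d + 1) : ℕ) : ℤ) =
        (((e + 1) * 10 ^ (l₁ + l₂) + (d + 1) * 10 ^ l₂ : ℕ) : ℤ) := by rw [h]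
      rw [pow_add, ht] at hz2
      push_cast at hz2 ⊢
      linarith
    have : ((10 ^ 8 : ℕ) : ℤ) ∣ ((9 * padovan n + (d + 1) : ℕ) : ℤ) := by
      rw [hz]; push_cast; exact dvd_mul_right _ _
    exact Nat.mod_eq_zero_of_dvd (by exact_mod_cast this)
  have hinA : inA (d + 1) (n % 896 % 8) = true := by
    rcases hA' with h5 | h5
    · exfalso; apply h5; omega
    · exact h5
  rcases hB' with (h5 | h5) | h5
  · apply h5; omega
  · rw [show n % 600 % 8 = n % 896 % 8 by omega, hinA] at h5
    simp at h5
  · rcases h5 e (by omega) with h6 | h6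
    · omega
    · apply h6 (l₁ % 4) (Nat.mod_lt _ (by norm_num)) (l₂ % 4) (Nat.mod_lt _ (by norm_num))
      have m2 := ten_mod l₂
      have m12 : 10 ^ (l₁ + l₂) ≡ 10 ^ (l₁ % 4 + l₂ % 4) [MOD 1111] := by
        rw [pow_add, pow_add]; exact (ten_mod l₁).mul m2
      have mp : padovan n % 138875 ≡ padovan n [MOD 1111] :=
        (Nat.mod_modEq _ _).of_dvd (by norm_num)
      have c1 : 9 * (padovan n % 138875) + (e + 1) * 10 ^ (l₂ % 4) + (d + 1) ≡
          9 * padovan n + (e + 1) * 10 ^ l₂ + (d + 1) [MOD 1111] :=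
        ((mp.mul_left 9).add (m2.symm.mul_left _)).add_right _
      have c2 : (e + 1) * 10 ^ (l₁ + l₂) + (d + 1) * 10 ^ l₂ ≡
          (e + 1) * 10 ^ (l₁ % 4 + l₂ % 4) + (d + 1) * 10 ^ (l₂ % 4) [MOD 1111] :=
        (m12.mul_left _).add (m2.mul_left _)
      rw [h] at c1
      exact c1.trans c2


/-! ### Powers of two dividing Padovan numbers -/

def pQ : ℕ → ℤ
  | 0 => 0
  | 1 => -3
  | 2 => 4
  | n + 3 => pQ (n + 1) + pQ n

lemma pQ_rec (n : ℕ) : pQ (n + 3) = pQ (n + 1) + pQ n := by rw [pQ]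

lemma pQ_pad (n : ℕ) : pQ (n + 16) = padovan n ∧ pQ (n + 17) = padovan (n + 1) ∧
    pQ (n + 18) = padovan (n + 2) := by
  induction n with
  | zero => simp [pQ, padovan]
  | succ n ih =>
    refine ⟨ih.2.1, ih.2.2, ?_⟩
    rw [show n + 1 + 18 = (n + 16) + 3 by ring, pQ_rec, show n + 1 + 2 = n + 3 by ring, pad_rec,
      show n + 16 + 1 = n + 17 by ring, ih.1, ih.2.1]
    push_cast
    ring

def pL (x y z : ℤ) (m : ℕ) : ℤ := x * pQ m + y * pQ (m + 1) + z * pQ (m + 2)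

lemma shift_base (m : ℕ) : pQ (m + 28) = pQ m + 8 * pL 58 102 77 m ∧
    pQ (m + 1 + 28) = pQ (m + 1) + 8 * pL 58 102 77 (m + 1) ∧
    pQ (m + 2 + 28) = pQ (m + 2) + 8 * pL 58 102 77 (m + 2) := by
  induction m with
  | zero => simp [pQ, pL]
  | succ m ih =>
    refine ⟨ih.2.1, ih.2.2, ?_⟩
    have h1 := ih.1
    have h2 := ih.2.1
    rw [show m + 1 + 2 + 28 = (m + 28) + 3 by ring, pQ_rec, show m + 28 + 1 = m + 1 + 28 by ring,
      h1, h2]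
    simp only [pL, show m + 1 + 2 = m + 3 by ring, show m + 1 + 1 = m + 2 by ring,
      show m + 3 + 1 = (m + 1) + 3 by ring, show m + 3 + 2 = (m + 2) + 3 by ring, pQ_rec,
      show m + 2 + 1 = m + 3 by ring]
    ring

lemma shift_pow (i : ℕ) : ∃ x y z : ℤ, x % 4 = 2 ∧ y % 4 = 2 ∧ z % 4 = 1 ∧
    ∀ m, pQ (m + 7 * 2 ^ (i + 2)) = pQ m + 2 ^ (i + 3) * pL x y z m := by
  induction i with
  | zero => exact ⟨58, 102, 77, by norm_num, by norm_num, by norm_num, fun m => (shift_base m).1⟩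
  | succ i ih =>
    obtain ⟨x, y, z, hx, hy, hz, h⟩ := ih
    refine ⟨x + 2 ^ (i + 2) * (x ^ 2 + 2 * y * z), y + 2 ^ (i + 2) * (2 * x * y + 2 * y * z + z ^ 2),
      z + 2 ^ (i + 2) * (y ^ 2 + 2 * x * z + z ^ 2), ?_, ?_, ?_, ?_⟩
    · rw [pow_add, mul_assoc, mul_left_comm]; norm_num; omega
    · rw [pow_add, mul_assoc, mul_left_comm]; norm_num; omega
    · rw [pow_add, mul_assoc, mul_left_comm]; norm_num; omega
    · intro m
      have e : m + 7 * 2 ^ (i + 1 + 2) = (m + 7 * 2 ^ (i + 2)) + 7 * 2 ^ (i + 2) := by ring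
      rw [e, h]
      have h0 := h m
      have h1 := h (m + 1)
      have h2 := h (m + 2)
      have hL : pL x y z (m + 7 * 2 ^ (i + 2)) = x * pQ (m + 7 * 2 ^ (i + 2)) +
        y * pQ (m + 1 + 7 * 2 ^ (i + 2)) + z * pQ (m + 2 + 7 * 2 ^ (i + 2)) := by
        unfold pL
        rw [show m + 7 * 2 ^ (i + 2) + 1 = m + 1 + 7 * 2 ^ (i + 2) by ring,
          show m + 7 * 2 ^ (i + 2) + 2 = m + 2 + 7 * 2 ^ (i + 2) by ring]
      rw [hL, h0, h1, h2]
      simp only [pL, show m + 1 + 1 = m + 2 by ring, show m + 1 + 2 = m + 3 by ring,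
        show m + 2 + 1 = m + 3 by ring, show m + 2 + 2 = (m + 1) + 3 by ring, pQ_rec]
      ring

lemma shift_mul (i : ℕ) (x y z : ℤ)
    (h : ∀ m, pQ (m + 7 * 2 ^ (i + 2)) = pQ m + 2 ^ (i + 3) * pL x y z m) (t : ℕ) :
    ∀ m, ∃ w : ℤ, pQ (m + 7 * 2 ^ (i + 2) * t) = pQ m + 2 ^ (i + 3) * (t * pL x y z m) +
      2 ^ (i + 5) * w := by
  induction t with
  | zero => intro m; exact ⟨0, by simp⟩
  | succ t ih =>
    intro m
    obtain ⟨w0, h0⟩ := ih m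
    obtain ⟨w1, h1⟩ := ih (m + 1)
    obtain ⟨w2, h2⟩ := ih (m + 2)
    have e : m + 7 * 2 ^ (i + 2) * (t + 1) = (m + 7 * 2 ^ (i + 2) * t) + 7 * 2 ^ (i + 2) := by ring
    rw [e, h]
    have hL : pL x y z (m + 7 * 2 ^ (i + 2) * t) = x * pQ (m + 7 * 2 ^ (i + 2) * t) +
        y * pQ (m + 1 + 7 * 2 ^ (i + 2) * t) + z * pQ (m + 2 + 7 * 2 ^ (i + 2) * t) := by
      unfold pL
      rw [show m + 7 * 2 ^ (i + 2) * t + 1 = m + 1 + 7 * 2 ^ (i + 2) * t by ring,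
        show m + 7 * 2 ^ (i + 2) * t + 2 = m + 2 + 7 * 2 ^ (i + 2) * t by ring]
    rw [hL, h0, h1, h2]
    refine ⟨w0 + 2 ^ (i + 1) * (x * (t * pL x y z m + 4 * w0) +
      y * (t * pL x y z (m + 1) + 4 * w1) + z * (t * pL x y z (m + 2) + 4 * w2)), ?_⟩
    push_cast
    have : pL x y z m = x * pQ m + y * pQ (m + 1) + z * pQ (m + 2) := rfl
    linear_combination (-(2 : ℤ) ^ (i + 3)) * this

lemma two_pow_Q (i : ℕ) : ∀ n : ℕ, (2 : ℤ) ^ (i + 4) ∣ pQ (n + 16) →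
    ∃ s t : ℕ, (s = 0 ∨ s = 9 ∨ s = 13 ∨ s = 14 ∨ s = 16) ∧ n + 16 = s + 7 * 2 ^ (i + 2) * t := by
  induction i with
  | zero =>
    intro n hn
    rw [(pQ_pad n).1] at hn
    have h1 : padovan n % 16 = 0 := Nat.mod_eq_zero_of_dvd (by exact_mod_cast hn)
    rw [pad_mod 16 56 (by decide +kernel)] at h1
    have h2 : ∀ r < 56, padovan r % 16 = 0 → r % 28 = 12 ∨ r % 28 = 21 ∨ r % 28 = 25 ∨ r % 28 = 26 ∨
      r % 28 = 0 := by decide +kernel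
    have h3 := h2 (n % 56) (Nat.mod_lt _ (by norm_num)) h1
    rcases h3 with h | h | h | h | h
    · exact ⟨0, (n + 16) / 28, by simp, by norm_num; omega⟩
    · exact ⟨9, (n + 16) / 28, by simp, by norm_num; omega⟩
    · exact ⟨13, (n + 16) / 28, by simp, by norm_num; omega⟩
    · exact ⟨14, (n + 16) / 28, by simp, by norm_num; omega⟩
    · exact ⟨16, (n + 16) / 28, by simp, by norm_num; omega⟩
  | succ i ih =>
    intro n hn
    obtain ⟨s, t, hs, hst⟩ := ih n (dvd_trans (pow_dvd_pow _ (by omega)) hn)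
    refine ⟨s, t / 2, hs, ?_⟩
    suffices ht : t % 2 = 0 by
      obtain ⟨u, rfl⟩ : ∃ u, t = 2 * u := ⟨t / 2, by omega⟩
      rw [hst, Nat.mul_div_cancel_left _ (by norm_num)]
      ring
    obtain ⟨x, y, z, hx, hy, hz, h⟩ := shift_pow i
    obtain ⟨w, hw⟩ := shift_mul i x y z h t s
    rw [hst, hw] at hn
    have hQs : pQ s = 0 := by rcases hs with rfl | rfl | rfl | rfl | rfl <;> decide +kernel
    rw [hQs, zero_add] at hn
    have hd : (4 : ℤ) ∣ t * pL x y z s := by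
      have e1 : (2 : ℤ) ^ (i + 1 + 4) = 2 ^ (i + 3) * 4 := by ring
      have e2 : (2 : ℤ) ^ (i + 5) = 2 ^ (i + 1 + 4) := by ring
      rw [e2] at hn
      have h3 := (dvd_add_left (Dvd.intro _ rfl)).1 hn
      rw [e1] at h3
      exact (mul_dvd_mul_iff_left (by positivity)).1 h3
    have hc : pL x y z s % 4 = 1 ∨ pL x y z s % 4 = 2 ∨ pL x y z s % 4 = 3 := by
      unfold pL
      rw [hQs]
      rcases hs with rfl | rfl | rfl | rfl | rfl <;> simp [pQ] <;> omega
    by_contra ht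
    have ht4 : (t : ℤ) % 4 = 1 ∨ (t : ℤ) % 4 = 3 := by omega
    have h5 := Int.emod_eq_zero_of_dvd hd
    rw [Int.mul_emod] at h5
    rcases hc with hc | hc | hc <;> rcases ht4 with ht4 | ht4 <;> rw [hc, ht4] at h5 <;> norm_num at h5

lemma part_A2 (n l : ℕ) (hn : 500 < n) (h : 2 ^ l ∣ padovan n) : 2 ^ l ≤ n + 16 := by
  rcases lt_or_ge l 4 with hl | hl
  · have : 2 ^ l ≤ 2 ^ 4 := Nat.pow_le_pow_right (by norm_num) (by omega)
    omega
  · obtain ⟨i, rfl⟩ : ∃ i, l = i + 4 := ⟨l - 4, by omega⟩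
    have h1 : (2 : ℤ) ^ (i + 4) ∣ pQ (n + 16) := by
      rw [(pQ_pad n).1]; exact_mod_cast h
    obtain ⟨s, t, hs, hst⟩ := two_pow_Q i n h1
    have ht : 1 ≤ t := by
      rcases Nat.eq_zero_or_pos t with rfl | ht
      · omega
      · exact ht
    have h2 : 7 * 2 ^ (i + 2) * 1 ≤ 7 * 2 ^ (i + 2) * t := Nat.mul_le_mul_left _ ht
    have h3 : 2 ^ (i + 4) = 4 * 2 ^ (i + 2) := by ring
    omega

lemma part_A (n d₁ d₂ l₁ l₂ : ℕ) (hn : 500 < n) (hd1 : 0 < d₁) (hd19 : d₁ ≤ 9) (hd2 : d₂ ≤ 9)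
    (hne : d₁ ≠ d₂)
    (h : 9 * padovan n + d₁ * 10 ^ l₂ + d₂ = d₁ * 10 ^ (l₁ + l₂) + d₂ * 10 ^ l₂) :
    2 ^ l₂ ≤ n + 16 := by
  rcases Nat.eq_zero_or_pos d₂ with rfl | hd20
  · apply part_A2 n l₂ hn
    have h1 : 2 ^ l₂ ∣ 9 * padovan n := by
      have h2 : (2 : ℕ) ^ l₂ ∣ 10 ^ l₂ := pow_dvd_pow_of_dvd (by norm_num) _
      have h3 : 2 ^ l₂ ∣ d₁ * 10 ^ (l₁ + l₂) := by
        rw [pow_add]; exact (h2.mul_left _).mul_left _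
      have h4 : 9 * padovan n + d₁ * 10 ^ l₂ = d₁ * 10 ^ (l₁ + l₂) := by simpa using h
      rw [← h4] at h3
      exact (Nat.dvd_add_left (h2.mul_left _)).1 h3
    exact (Nat.Coprime.pow_left _ (by norm_num)).dvd_of_dvd_mul_left h1
  · have := part_A1 n d₁ d₂ l₁ l₂ hd1 hd19 hd2 hd20 hne h
    have h2 : 2 ^ l₂ ≤ 2 ^ 7 := Nat.pow_le_pow_right (by norm_num) this
    omega


/-! ### Final assembly -/

def chkF (n a : ℕ) : Bool :=
  Nat.ble n 500 || (Nat.ble (10 ^ 12) (9 * a % 10 ^ 25) && Nat.ble (9 * a % 10 ^ 25) (10 ^ 25 - 10 ^ 12))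

set_option maxRecDepth 100000 in
lemma loopF : ploop (10 ^ 25) chkF 2600 0 0 (1 % 10 ^ 25) (1 % 10 ^ 25) = true := by decide +kernel

lemma final_small (n d₁ d₂ l₁ l₂ : ℕ) (hn : 500 < n) (hn2 : n < 2600) (hd19 : d₁ ≤ 9)
    (hd2 : d₂ ≤ 9) (hl2 : l₂ ≤ 11) (hm : 25 ≤ l₁ + l₂)
    (h : 9 * padovan n + d₁ * 10 ^ l₂ + d₂ = d₁ * 10 ^ (l₁ + l₂) + d₂ * 10 ^ l₂) : False := by
  have h1 := ploop_zero (10 ^ 25) chkF 2600 loopF n hn2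
  simp only [chkF, Bool.or_eq_true, Bool.and_eq_true, Nat.ble_eq] at h1
  rcases h1 with h1 | ⟨h1, h2⟩
  · omega
  obtain ⟨z, hz⟩ : 10 ^ 25 ∣ 10 ^ (l₁ + l₂) := pow_dvd_pow _ hm
  have hB : 10 ^ l₂ ≤ 10 ^ 11 := Nat.pow_le_pow_right (by norm_num) hl2
  have hu : d₁ * 10 ^ l₂ ≤ 9 * 10 ^ 11 := Nat.mul_le_mul hd19 hB
  have hv : d₂ * 10 ^ l₂ ≤ 9 * 10 ^ 11 := Nat.mul_le_mul hd2 hB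
  rw [hz, show d₁ * (10 ^ 25 * z) = 10 ^ 25 * (d₁ * z) by ring] at h
  generalize d₁ * 10 ^ l₂ = u at *
  generalize d₂ * 10 ^ l₂ = v at *
  generalize d₁ * z = w at *
  generalize padovan n = P at *
  norm_num at h1 h2 h hu hv
  generalize 9 * P = G at *
  rcases le_or_gt w (G / 10000000000000000000000000) with hw | hw <;> omega

lemma growth (n d₁ d₂ l₁ l₂ : ℕ) (hn : 500 < n) (hd1 : 0 < d₁) (hd19 : d₁ ≤ 9) (hd2 : d₂ ≤ 9)
    (hl1 : 1 ≤ l₁)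
    (h : 9 * padovan n + d₁ * 10 ^ l₂ + d₂ = d₁ * 10 ^ (l₁ + l₂) + d₂ * 10 ^ l₂) :
    n ≤ 12 * (l₁ + l₂) + 4 ∧ l₁ + l₂ ≤ n + 3 := by
  have hB : 1 ≤ 10 ^ l₂ := Nat.one_le_pow _ _ (by norm_num)
  have hAB : 10 * 10 ^ l₂ ≤ 10 ^ (l₁ + l₂) := by
    rw [pow_add]
    exact Nat.mul_le_mul_right _ (Nat.le_self_pow (by omega) 10)
  have h3 : (2 : ℕ) ^ (3 * (l₁ + l₂)) ≤ 10 ^ (l₁ + l₂) := by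
    rw [pow_mul]; exact Nat.pow_le_pow_left (by norm_num) _
  have h4 : 10 ^ (l₁ + l₂) ≤ (2 : ℕ) ^ (4 * (l₁ + l₂)) := by
    rw [pow_mul]; exact Nat.pow_le_pow_left (by norm_num) _
  have g1 := pad_ge' n (by omega)
  have g2 := (pad_lt n).1
  generalize 10 ^ (l₁ + l₂) = A at *
  generalize 10 ^ l₂ = B at *
  have hu : padovan n < A := by
    have a1 : d₁ * (A - B) ≤ 9 * (A - B) := Nat.mul_le_mul_right _ hd19
    have a2 : d₂ * (B - 1) ≤ 9 * (B - 1) := Nat.mul_le_mul_right _ hd2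
    have a3 : d₁ * (A - B) + d₁ * B = d₁ * A := by rw [← Nat.mul_add]; congr 1; omega
    have a4 : d₂ * (B - 1) + d₂ = d₂ * B := by
      conv_lhs => rw [← Nat.mul_succ]
      congr 1; omega
    omega
  have hlow : A ≤ 10 * padovan n := by
    have a1 : 1 * (A - B) ≤ d₁ * (A - B) := Nat.mul_le_mul_right _ hd1
    have a3 : d₁ * (A - B) + d₁ * B = d₁ * A := by rw [← Nat.mul_add]; congr 1; omega
    have a4 : d₂ * 1 ≤ d₂ * B := Nat.mul_le_mul_left _ hB
    omega
  constructor
  · have : (2 : ℕ) ^ ((n - 5) / 3) < 2 ^ (4 * (l₁ + l₂)) := by omega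
    have := (Nat.pow_lt_pow_iff_right (by norm_num : 1 < 2)).1 this
    omega
  · have : (2 : ℕ) ^ (3 * (l₁ + l₂)) ≤ 2 ^ (n + 4) := by rw [pow_add]; omega
    have := (Nat.pow_le_pow_iff_right (by norm_num : 1 < 2)).1 this
    omega

lemma two_pow_lin (l : ℕ) (hl : 12 ≤ l) : 300 * l ≤ 2 ^ l := by
  induction l, hl using Nat.le_induction with
  | base => norm_num
  | succ l hl ih => rw [pow_succ]; omega

lemma final_large (n d₁ d₂ l₁ l₂ : ℕ) (hn : 2 ^ 600 ≤ n + 3) (hd1 : 0 < d₁) (hd19 : d₁ ≤ 9)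
    (hd2 : d₂ ≤ 9) (hl1 : 1 ≤ l₁) (hl2 : 1 ≤ l₂) (hA : 2 ^ l₂ ≤ n + 16)
    (h : 9 * padovan n + d₁ * 10 ^ l₂ + d₂ = d₁ * 10 ^ (l₁ + l₂) + d₂ * 10 ^ l₂) : False := by
  have hbig : 500 < n := by
    have : (2 : ℕ) ^ 10 ≤ 2 ^ 600 := Nat.pow_le_pow_right (by norm_num) (by norm_num)
    omega
  obtain ⟨hg1, hg2⟩ := growth n d₁ d₂ l₁ l₂ hbig hd1 hd19 hd2 hl1 h
  set e := Nat.log 2 (n + 3) with he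
  have he1 : 2 ^ e ≤ n + 3 := Nat.pow_log_le_self 2 (by omega)
  have he2 : n + 3 < 2 ^ (e + 1) := Nat.lt_pow_succ_log_self (by norm_num) _
  have he600 : 600 ≤ e := (Nat.le_log_iff_pow_le (by norm_num) (by omega)).2 hn
  have hl2e : l₂ ≤ e + 1 := by
    have h16 : (2 : ℕ) ^ 4 ≤ 2 ^ (e + 1) := Nat.pow_le_pow_right (by norm_num) (by omega)
    have : 2 ^ l₂ < 2 ^ (e + 2) := by rw [pow_succ _ (e + 1)]; omega
    have := (Nat.pow_lt_pow_iff_right (by norm_num : 1 < 2)).1 this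
    omega
  have hZ := pow_e_bound e he600
  have hb := baker_bound e (n + 3) (l₁ + l₂) d₁ he600 he2 hg2 hd1 hd19
  have hZe : 100 * e ≤ 2 ^ 306 * e ^ 22 := by
    have h1 : (100 : ℕ) ≤ 2 ^ 306 := le_trans (by norm_num) (Nat.pow_le_pow_right (by norm_num) (by norm_num : 7 ≤ 306))
    exact Nat.mul_le_mul h1 (Nat.le_self_pow (by norm_num) e)
  have h312 : 2 ^ 312 * e ^ 22 = 64 * (2 ^ 306 * e ^ 22) := by
    rw [← mul_assoc]; congr 1
  rw [h312] at hZ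
  generalize 2 ^ 306 * e ^ 22 = Z at *
  clear_value e
  have hl1Z : Z + 5 ≤ 3 * l₁ := by
    clear hb h312 h
    omega
  have hlf := lin_form n d₁ d₂ l₁ l₂ hd1 hd19 hd2 (by omega) hl2 h
  have hp : (0 : ℝ) < 10 ^ l₁ := by positivity
  have h5 := lt_of_lt_of_le (mul_lt_mul_of_pos_right hb hp) hlf
  have h6 : (2 : ℝ) ^ (Z + 5) ≤ 10 ^ l₁ := by
    calc (2 : ℝ) ^ (Z + 5) ≤ 2 ^ (3 * l₁) := pow_le_pow_right₀ (by norm_num) hl1Z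
      _ = (2 ^ 3) ^ l₁ := by rw [pow_mul]
      _ ≤ 10 ^ l₁ := by gcongr; norm_num
  have h7 : (1 / 2 : ℝ) ^ Z * 2 ^ (Z + 5) ≤ (1 / 2 : ℝ) ^ Z * 10 ^ l₁ := by gcongr
  have h8 : (1 / 2 : ℝ) ^ Z * 2 ^ (Z + 5) = 32 := by
    rw [pow_add, ← mul_assoc, ← mul_pow]; norm_num
  linarith

lemma final_mid (n d₁ d₂ l₁ l₂ : ℕ) (hn5 : 500 < n) (hn : n + 3 < 2 ^ 600) (hd1 : 0 < d₁)
    (hd19 : d₁ ≤ 9) (hd2 : d₂ ≤ 9) (hl1 : 1 ≤ l₁) (hl2 : 1 ≤ l₂) (hA : 2 ^ l₂ ≤ n + 16)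
    (h : 9 * padovan n + d₁ * 10 ^ l₂ + d₂ = d₁ * 10 ^ (l₁ + l₂) + d₂ * 10 ^ l₂) : False := by
  obtain ⟨hg1, hg2⟩ := growth n d₁ d₂ l₁ l₂ hn5 hd1 hd19 hd2 hl1 h
  have hl12 : 2 ≤ l₁ := by
    by_contra hc
    have := two_pow_lin l₂ (by omega)
    omega
  have hlf := lin_form n d₁ d₂ l₁ l₂ hd1 hd19 hd2 hl12 hl2 h
  have hbd := bd_bound (n + 3) (l₁ + l₂) d₁ hn.le hd1 hd19
  have hp : (0 : ℝ) < 10 ^ l₁ := by positivity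
  have h1 : (10 : ℝ) ^ l₁ ≤ 48 * qq := by
    have hq : (0 : ℝ) ≤ qq := Nat.cast_nonneg _
    generalize |((n + 3 : ℕ) : ℝ) * Real.log pr - ((l₁ + l₂ : ℕ) : ℝ) * Real.log 10 -
      Real.log (al3 d₁)| = X at *
    generalize (10 : ℝ) ^ l₁ = T at *
    generalize (qq : ℝ) = q at *
    have a1 := mul_le_mul_of_nonneg_right hbd hp.le
    have a2 := mul_le_mul_of_nonneg_left hlf hq
    linarith
  have h2 : 10 ^ l₁ ≤ 48 * qq := by exact_mod_cast h1
  have h3 : 10 ^ l₁ < 2 ^ 615 := by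
    have := qq_lt
    have e : (2 : ℕ) ^ 615 = 64 * 2 ^ 609 := by rw [show 615 = 6 + 609 by norm_num, pow_add]; norm_num
    rw [e]
    omega
  have h4 : (2 : ℕ) ^ (3 * l₁) ≤ 10 ^ l₁ := by
    rw [pow_mul]; exact Nat.pow_le_pow_left (by norm_num) _
  have h5 := (Nat.pow_lt_pow_iff_right (by norm_num : 1 < 2)).1 (lt_of_le_of_lt h4 h3)
  have hl211 : l₂ ≤ 11 := by
    by_contra hc
    have := two_pow_lin l₂ (by omega)
    clear h3 h2 hn
    omega
  clear hn h3 h2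
  exact final_small n d₁ d₂ l₁ l₂ hn5 (by omega) hd19 hd2 hl211 (by omega) h


/-- There is no Padovan number `P n` with `n > 500` that is a concatenation of two
distinct repdigits. -/
theorem no_large_padovan_concat :
    ¬∃ (n d₁ d₂ ℓ₁ ℓ₂ : ℕ), 500 < n ∧ d₁ ≤ 9 ∧ d₂ ≤ 9 ∧ d₁ ≠ d₂ ∧ 0 < d₁ ∧
      1 ≤ ℓ₁ ∧ 1 ≤ ℓ₂ ∧
      padovan n = d₁ * ((10 ^ ℓ₁ - 1) / 9) * 10 ^ ℓ₂ + d₂ * ((10 ^ ℓ₂ - 1) / 9) := by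
  rintro ⟨n, d₁, d₂, l₁, l₂, hn, hd19, hd2, hne, hd1, hl1, hl2, h⟩
  have h9 := eq_nat n d₁ d₂ l₁ l₂ h
  have hA := part_A n d₁ d₂ l₁ l₂ hn hd1 hd19 hd2 hne h9
  rcases lt_or_ge (n + 3) (2 ^ 600) with hc | hc
  · exact final_mid n d₁ d₂ l₁ l₂ hn hc hd1 hd19 hd2 hl1 hl2 hA h9
  · exact final_large n d₁ d₂ l₁ l₂ hc hd1 hd19 hd2 hl1 hl2 hA h9
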